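/- Let T be an ℝ-tree with a very small, minimal, isometric action of the free group F_N (N ≥ 2) with dense orbits, and let 𝒜 be a basis of F_N. Then there exist a constant C > 0 and a sequence of finite subtrees K(n) ⊆ T̄ of diameter at most C, with K(n) ∩ aK(n) ≠ ∅ for all a ∈ 𝒜, such that the trees T_{𝒦(n)} associated to the induced systems of isometries 𝒦(n) = (K(n),𝒜) converge to T: for every w ∈ F_N, the translation lengths ‖w‖_{T_{𝒦(n)}} converge to ‖w‖_T as n → ∞. -/

import Mathlib

/-!
Common formalization framework for "ℝ-trees, dual laminations, and compact systems
of partial isometries" (Coulbois–Hilion–Lustig).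
-/

open Set Filter Topology Pointwise

noncomputable section

namespace CHL

/-! ### ℝ-trees -/

/-- The metric betweenness segment `[x,y]`.  In an ℝ-tree this is exactly the unique
topological arc joining `x` to `y`, which is a geodesic segment. -/
def seg {T : Type*} [MetricSpace T] (x y : T) : Set T :=
  {z | dist x z + dist z y = dist x y}

/-- An ℝ-tree: a geodesic metric space which is `0`-hyperbolic (four point condition).
Equivalently, any two points are joined by a unique topological arc, and this arc is a
geodesic segment. -/
class IsRTree (T : Type*) [MetricSpace T] : Prop where
  geodesic : ∀ x y : T, ∃ f : ℝ → T, f 0 = x ∧ f (dist x y) = y ∧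
      ∀ s ∈ Set.Icc (0 : ℝ) (dist x y), ∀ t ∈ Set.Icc (0 : ℝ) (dist x y),
        dist (f s) (f t) = |s - t|
  four_point : ∀ x y z w : T,
      dist x y + dist z w ≤ max (dist x z + dist y w) (dist x w + dist y z)

/-- A subtree of an ℝ-tree: a convex subset. -/
def IsSubtree {T : Type*} [MetricSpace T] (A : Set T) : Prop :=
  ∀ x ∈ A, ∀ y ∈ A, seg x y ⊆ A

/-- A non-empty closed subtree. -/
def IsClosedSubtree {T : Type*} [MetricSpace T] (A : Set T) : Prop :=
  A.Nonempty ∧ IsClosed A ∧ IsSubtree A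

/-- The convex hull of a subset of an ℝ-tree: the smallest subtree containing it. -/
def subtreeHull {T : Type*} [MetricSpace T] (S : Set T) : Set T :=
  ⋂₀ {A : Set T | S ⊆ A ∧ IsSubtree A}

/-- A finite tree: the convex hull of finitely many points. -/
def IsFiniteSubtree {T : Type*} [MetricSpace T] (A : Set T) : Prop :=
  ∃ F : Finset T, A = subtreeHull (F : Set T)

/-- `[x,x']` is the segment joining `A` to `B`: its endpoints are the only points
in `A` resp. `B` that it meets. -/
def IsBridge {T : Type*} [MetricSpace T] (A B : Set T) (x x' : T) : Prop :=
  x ∈ A ∧ x' ∈ B ∧ seg x x' ∩ A = {x} ∧ seg x x' ∩ B = {x'}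

/-- A morphism of ℝ-trees: a continuous map such that every segment is mapped locally
injectively except at finitely many points. -/
def IsTreeMorphism {T T' : Type*} [MetricSpace T] [MetricSpace T'] (f : T → T') : Prop :=
  Continuous f ∧ ∀ x y : T, ∃ F : Finset T, ∀ p ∈ seg x y, p ∉ (F : Set T) →
    ∃ U ∈ nhdsWithin p (seg x y), Set.InjOn f U

/-- The translation length `‖g‖_T = inf_{x ∈ T} d(x, gx)`. -/
def translationLength (G : Type*) [Group G] (T : Type*) [MetricSpace T] [MulAction G T]
    (g : G) : ℝ :=
  ⨅ x : T, dist x (g • x)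

/-- The translation length of `g` on an invariant subtree `A`. -/
def translationLengthOn {G : Type*} [Group G] {T : Type*} [MetricSpace T] [MulAction G T]
    (A : Set T) (g : G) : ℝ :=
  ⨅ x : A, dist (x : T) (g • (x : T))

/-- The minimal `G`-invariant subtree. -/
def minSubtree (G : Type*) [Group G] (T : Type*) [MetricSpace T] [MulAction G T] : Set T :=
  ⋂₀ {A : Set T | A.Nonempty ∧ IsSubtree A ∧ ∀ g : G, ∀ x ∈ A, g • x ∈ A}

/-! ### Free groups, reduced words and the boundary `∂F(𝒜)` -/

/-- Two letters of `𝒜^{±1}` are inverse to each other. -/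
def LettersInv {ι : Type*} (a b : ι × Bool) : Prop := a.1 = b.1 ∧ a.2 = !b.2

/-- The prefix of length `n` of (the reduced word of) `w`. -/
def gprefix {ι : Type*} [DecidableEq ι] (w : FreeGroup ι) (n : ℕ) : FreeGroup ι :=
  FreeGroup.mk (w.toWord.take n)

/-- An infinite reduced word in the letters `𝒜^{±1}`: a point of the Gromov boundary
`∂F(𝒜)` of the free group `F(𝒜)`. -/
structure InfWord (ι : Type*) where
  letter : ℕ → ι × Bool
  reduced : ∀ n, ¬ LettersInv (letter n) (letter (n + 1))

/-- The prefix `X_n` of length `n` of an infinite reduced word `X`. -/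
def InfWord.prefixN {ι : Type*} (X : InfWord ι) (n : ℕ) : FreeGroup ι :=
  FreeGroup.mk (List.ofFn fun i : Fin n => X.letter i)

/-- The infinite word `X_k⁻¹ X` obtained by deleting the first `k` letters. -/
def InfWord.shift {ι : Type*} (X : InfWord ι) (k : ℕ) : InfWord ι :=
  ⟨fun n => X.letter (k + n), fun n => X.reduced (k + n)⟩

/-- A sequence `wₙ ∈ F(𝒜)` converges in `F(𝒜) ∪ ∂F(𝒜)` to the infinite word `X` iff
the length of the maximal common prefix of `wₙ` and `X` tends to infinity. -/
def TendstoBoundary {ι : Type*} [DecidableEq ι] (w : ℕ → FreeGroup ι) (X : InfWord ι) : Prop :=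
  ∀ k : ℕ, ∀ᶠ n in atTop, (w n).toWord.take k = List.ofFn fun i : Fin k => X.letter i

/-- `Y = w · X` for the left action of `F(𝒜)` on its boundary `∂F(𝒜)`. -/
def SmulBoundary {ι : Type*} [DecidableEq ι] (w : FreeGroup ι) (X Y : InfWord ι) : Prop :=
  TendstoBoundary (fun n => w * X.prefixN n) Y

/-- The (Cantor set) topology on `∂F(𝒜)`, induced by the product topology on sequences
of letters. -/
instance {ι : Type*} : TopologicalSpace (InfWord ι) :=
  TopologicalSpace.induced (fun X => X.letter)
    (@Pi.topologicalSpace ℕ (fun _ => ι × Bool) fun _ => ⊥)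

/-- A non-trivial element of `F(𝒜)` is cyclically reduced if the first letter of its reduced
word is not the inverse of its last letter. -/
def IsCyclicallyReduced {ι : Type*} [DecidableEq ι] (w : FreeGroup ι) : Prop :=
  w ≠ 1 ∧ ∀ a ∈ w.toWord.head?, ∀ b ∈ w.toWord.getLast?, ¬ LettersInv a b

/-- The dual laminary language `ℒ_𝒜(T)` of an isometric action of `F(𝒜)` on `T`. -/
def dualLanguage (ι : Type*) [DecidableEq ι] (T : Type*) [MetricSpace T]
    [MulAction (FreeGroup ι) T] : Set (FreeGroup ι) :=
  {v | ∀ ε > (0 : ℝ), ∃ u w : FreeGroup ι,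
      (u * v * w).toWord = u.toWord ++ v.toWord ++ w.toWord ∧
      IsCyclicallyReduced (u * v * w) ∧
      translationLength (FreeGroup ι) T (u * v * w) < ε}

/-- The dual laminary language `ℒ_𝒜(T)`, for the action restricted to an invariant
subtree `A`. -/
def dualLanguageOn (ι : Type*) [DecidableEq ι] {T : Type*} [MetricSpace T]
    [MulAction (FreeGroup ι) T] (A : Set T) : Set (FreeGroup ι) :=
  {v | ∀ ε > (0 : ℝ), ∃ u w : FreeGroup ι,
      (u * v * w).toWord = u.toWord ++ v.toWord ++ w.toWord ∧
      IsCyclicallyReduced (u * v * w) ∧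
      translationLengthOn A (u * v * w) < ε}

/-! ### Systems of isometries on a compact ℝ-tree -/

/-- A system of isometries `𝒦 = (K, 𝒜)`: a family, indexed by `ι`, of non-empty partial
isometries of the compact ℝ-tree `K`, i.e. isometries between non-empty closed subtrees. -/
structure SystemOfIsometries (K : Type*) [MetricSpace K] (ι : Type*) where
  pe : ι → PartialEquiv K K
  isom : ∀ i, ∀ x ∈ (pe i).source, ∀ y ∈ (pe i).source, dist (pe i x) (pe i y) = dist x y
  source_subtree : ∀ i, IsClosedSubtree (pe i).source
  target_subtree : ∀ i, IsClosedSubtree (pe i).target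

namespace SystemOfIsometries

variable {K : Type*} [MetricSpace K] {ι : Type*} (S : SystemOfIsometries K ι)

/-- The partial isometry associated to a letter in `𝒜^{±1}`. -/
def letterPE : ι × Bool → PartialEquiv K K
  | (i, true) => S.pe i
  | (i, false) => (S.pe i).symm

/-- The partial isometry `z₁ ∘ z₂ ∘ ⋯ ∘ zₙ` (acting on the right: first `z₁`, then `z₂`, …)
associated to the reduced word `w = z₁ ⋯ zₙ ∈ F(𝒜)`. -/
def wordPE [DecidableEq ι] (w : FreeGroup ι) : PartialEquiv K K :=
  (w.toWord.map S.letterPE).foldl PartialEquiv.trans (PartialEquiv.refl K)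

/-- The domain `dom (w)` of the partial isometry associated to `w`. -/
def dom [DecidableEq ι] (w : FreeGroup ι) : Set K := (S.wordPE w).source

/-- A word is admissible if it is non-empty as a partial isometry of `K`. -/
def Admissible [DecidableEq ι] (w : FreeGroup ι) : Prop := (S.dom w).Nonempty

/-- An infinite word is admissible if all its prefixes are admissible. -/
def AdmissibleInf [DecidableEq ι] (X : InfWord ι) : Prop := ∀ n, S.Admissible (X.prefixN n)

/-- The domain of an infinite word: the intersection of the domains of its prefixes. -/
def domInf [DecidableEq ι] (X : InfWord ι) : Set K := ⋂ n, S.dom (X.prefixN n)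

/-- An infinite word `X` is eventually admissible if some suffix `X_k⁻¹ X` is admissible. -/
def EventuallyAdmissible [DecidableEq ι] (X : InfWord ι) : Prop :=
  ∃ k, S.AdmissibleInf (X.shift k)

/-- The system `𝒦` has independent generators if the (non-empty) domain of every
admissible infinite word consists of exactly one point. -/
def IndependentGenerators [DecidableEq ι] : Prop :=
  ∀ X : InfWord ι, S.AdmissibleInf X → ∃ x : K, S.domInf X = {x}

/-- The admissible laminary language `ℒ_adm(𝒦)`: the largest laminary language consisting of
admissible words; `w ∈ ℒ_adm(𝒦)` iff for every `k` the word `w` is obtained from some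
admissible word `v` by deleting its prefix and its suffix of length `k`. -/
def admLanguage [DecidableEq ι] : Set (FreeGroup ι) :=
  {w | ∀ k : ℕ, ∃ v : FreeGroup ι, S.Admissible v ∧
      ∃ p s : List (ι × Bool), p.length = k ∧ s.length = k ∧
        v.toWord = p ++ w.toWord ++ s}

end SystemOfIsometries

/-- The ℝ-tree `T_𝒦` associated to a system of isometries `𝒦 = (K, 𝒜)`, presented through
its characteristic properties (Theorem 3.2 of the paper, by which it is unique):
`T_𝒦` contains `K` as an isometrically embedded subtree (1); the left action of `F(𝒜)`
is compatible with the partial isometries (2); every orbit meets `K`, and indeed every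
segment is covered by finitely many translates of `K` (3); and `T_𝒦` is universal among
trees satisfying (1) and (2), via unique equivariant morphisms (4). -/
structure AssocTree {K : Type} [MetricSpace K] {ι : Type} [DecidableEq ι]
    (S : SystemOfIsometries K ι) where
  carrier : Type
  [ms : MetricSpace carrier]
  tree : IsRTree carrier
  [act : MulAction (FreeGroup ι) carrier]
  act_isom : ∀ g : FreeGroup ι, Isometry fun x : carrier => g • x
  emb : K → carrier
  emb_isom : Isometry emb
  emb_subtree : IsSubtree (Set.range emb)
  compat : ∀ i : ι, ∀ x ∈ (S.pe i).source, (FreeGroup.of i)⁻¹ • emb x = emb (S.pe i x)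
  orbit_meets : ∀ p : carrier, ∃ (w : FreeGroup ι) (x : K), p = w • emb x
  seg_cover : ∀ p q : carrier, ∃ F : Finset (FreeGroup ι),
      seg p q ⊆ ⋃ w ∈ F, w • Set.range emb
  universal : ∀ (T' : Type) [MetricSpace T'] [MulAction (FreeGroup ι) T'],
      (∀ g : FreeGroup ι, Isometry fun x : T' => g • x) →
      ∀ e' : K → T', Isometry e' →
      (∀ i : ι, ∀ x ∈ (S.pe i).source, (FreeGroup.of i)⁻¹ • e' x = e' (S.pe i x)) →
      ∃! f : carrier → T', IsTreeMorphism f ∧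
        (∀ (g : FreeGroup ι) (p : carrier), f (g • p) = g • f p) ∧
        ∀ x : K, f (emb x) = e' x

attribute [instance] AssocTree.ms AssocTree.act

/-! ### Very small minimal actions with dense orbits, and their metric completion -/

/-- An ℝ-tree `T` (here: the subtree `Tsub` of the complete ℝ-tree `Tb`, whose metric
completion `T̄` is `Tb`) with a very small, minimal, isometric action of the free group
`F(𝒜)` with dense orbits.  (For actions with dense orbits, "very small" is equivalent to
"trivial arc stabilizers".) -/
structure TreeSetup (ι : Type) where
  Tb : Type
  [ms : MetricSpace Tb]
  complete : CompleteSpace Tb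
  tree : IsRTree Tb
  [act : MulAction (FreeGroup ι) Tb]
  act_isom : ∀ g : FreeGroup ι, Isometry fun x : Tb => g • x
  Tsub : Set Tb
  nonempty : Tsub.Nonempty
  dense : Dense Tsub
  sub_subtree : IsSubtree Tsub
  invariant : ∀ g : FreeGroup ι, ∀ x ∈ Tsub, g • x ∈ Tsub
  minimal : ∀ A : Set Tb, A ⊆ Tsub → A.Nonempty → IsSubtree A →
      (∀ g : FreeGroup ι, ∀ x ∈ A, g • x ∈ A) → A = Tsub
  dense_orbits : ∀ x ∈ Tsub, Tsub ⊆ closure (Set.range fun g : FreeGroup ι => g • x)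
  arc_stab : ∀ g : FreeGroup ι, ∀ x ∈ Tsub, ∀ y ∈ Tsub, x ≠ y →
      (fun p => g • p) '' seg x y = seg x y → g = 1

attribute [instance] TreeSetup.ms TreeSetup.act

/-- `𝒬(X) = Q` (for `Q ∈ T̄`), where `𝒬 : ∂F_N → T̂` is the map of Levitt–Lustig:
it is characterized by the property that whenever a sequence `uₙ ∈ F_N` converges to
`X ∈ ∂F_N` and `uₙ P` converges metrically in `T̄` to a point `Q`, then `𝒬(X) = Q`. -/
def QRel {ι : Type} [DecidableEq ι] (St : TreeSetup ι) (X : InfWord ι) (Q : St.Tb) : Prop :=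
  ∃ P ∈ St.Tsub, ∃ u : ℕ → FreeGroup ι, TendstoBoundary u X ∧
    Tendsto (fun n => u n • P) atTop (𝓝 Q)

/-- The limit set `Ω_𝒜 = 𝒬²(C²_𝒜 ∩ L²(T)) ⊆ T̄`: images of pairs of distinct boundary
points with distinct first letters (w.r.t. the basis `𝒜`) that are identified by `𝒬`. -/
def limitSet {ι : Type} [DecidableEq ι] (St : TreeSetup ι) : Set St.Tb :=
  {Q | ∃ X Y : InfWord ι, X.letter 0 ≠ Y.letter 0 ∧ QRel St X Q ∧ QRel St Y Q}

/-- The heart `K_𝒜 ⊆ T̄`: the convex hull of the limit set `Ω_𝒜`. -/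
def heart {ι : Type} [DecidableEq ι] (St : TreeSetup ι) : Set St.Tb :=
  subtreeHull (limitSet St)

/-- The dual algebraic lamination `L²(T) = {(X,Y) ∈ ∂²F_N : 𝒬(X) = 𝒬(Y)}`. -/
def L2 {ι : Type} [DecidableEq ι] (St : TreeSetup ι) : Set (InfWord ι × InfWord ι) :=
  {p | p.1 ≠ p.2 ∧ ∃ Q : St.Tb, QRel St p.1 Q ∧ QRel St p.2 Q}

/-! ### The system of isometries induced on a compact subtree `K ⊆ T̄` -/

/-- The domain, inside `T̄`, of the partial isometry `x ↦ w⁻¹ x` of `K` induced by the word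
`w`: the intersection of the translates of `K` by the prefixes of `w`. -/
def inducedDom {ι : Type} [DecidableEq ι] (St : TreeSetup ι) (K : Set St.Tb)
    (w : FreeGroup ι) : Set St.Tb :=
  ⋂ n ∈ Finset.range (w.toWord.length + 1), gprefix w n • K

/-- Admissibility of a word for the induced system of isometries `𝒦 = (K, 𝒜)`. -/
def InducedAdmissible {ι : Type} [DecidableEq ι] (St : TreeSetup ι) (K : Set St.Tb)
    (w : FreeGroup ι) : Prop :=
  (inducedDom St K w).Nonempty

/-- The admissible laminary language `ℒ_adm(𝒦)` of the induced system `𝒦 = (K, 𝒜)`. -/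
def inducedAdmLanguage {ι : Type} [DecidableEq ι] (St : TreeSetup ι) (K : Set St.Tb) :
    Set (FreeGroup ι) :=
  {w | ∀ k : ℕ, ∃ v : FreeGroup ι, InducedAdmissible St K v ∧
      ∃ p s : List (ι × Bool), p.length = k ∧ s.length = k ∧
        v.toWord = p ++ w.toWord ++ s}

/-- Admissibility of an infinite word for the induced system `𝒦 = (K, 𝒜)`. -/
def InducedAdmissibleInf {ι : Type} [DecidableEq ι] (St : TreeSetup ι) (K : Set St.Tb)
    (X : InfWord ι) : Prop :=
  ∀ n, InducedAdmissible St K (X.prefixN n)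

/-- The domain `dom(X) = ⋂ₙ dom(Xₙ)` of an infinite word, for the induced system. -/
def inducedDomInf {ι : Type} [DecidableEq ι] (St : TreeSetup ι) (K : Set St.Tb)
    (X : InfWord ι) : Set St.Tb :=
  ⋂ n, X.prefixN n • K

/-- Compatibility of a map `e : K → T'` with the system of partial isometries induced on
`K ⊆ T̄` by the basis `𝒜`: this is condition (2) of Theorem 3.2 for the induced system. -/
def InducedCompat {ι : Type} (St : TreeSetup ι) (K : Set St.Tb) {T' : Type} [MetricSpace T']
    [MulAction (FreeGroup ι) T'] (e : K → T') : Prop :=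
  ∀ (i : ι) (x : K) (h : (FreeGroup.of i)⁻¹ • (x : St.Tb) ∈ K),
    (FreeGroup.of i)⁻¹ • e x = e ⟨(FreeGroup.of i)⁻¹ • (x : St.Tb), h⟩

/-- The tree `T_𝒦` associated to the system of isometries induced on a compact subtree
`K ⊆ T̄`, presented through the characteristic properties of Theorem 3.2 (by which it is
unique), together with the canonical `F(𝒜)`-equivariant morphism `j : T_𝒦 → T̄` restricting
to the identity on `K`. -/
structure InducedAssoc {ι : Type} (St : TreeSetup ι) (K : Set St.Tb) where
  TK : Type
  [ms : MetricSpace TK]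
  tree : IsRTree TK
  [act : MulAction (FreeGroup ι) TK]
  act_isom : ∀ g : FreeGroup ι, Isometry fun x : TK => g • x
  emb : K → TK
  emb_isom : Isometry emb
  emb_subtree : IsSubtree (Set.range emb)
  compat : InducedCompat St K emb
  orbit_meets : ∀ p : TK, ∃ (w : FreeGroup ι) (x : K), p = w • emb x
  seg_cover : ∀ p q : TK, ∃ F : Finset (FreeGroup ι),
      seg p q ⊆ ⋃ w ∈ F, w • Set.range emb
  universal : ∀ (T' : Type) [MetricSpace T'] [MulAction (FreeGroup ι) T'],
      (∀ g : FreeGroup ι, Isometry fun x : T' => g • x) →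
      ∀ e' : K → T', Isometry e' → InducedCompat St K e' →
      ∃! f : TK → T', IsTreeMorphism f ∧
        (∀ (g : FreeGroup ι) (p : TK), f (g • p) = g • f p) ∧
        ∀ x : K, f (emb x) = e' x
  jmap : TK → St.Tb
  jmap_morphism : IsTreeMorphism jmap
  jmap_equivariant : ∀ (g : FreeGroup ι) (p : TK), jmap (g • p) = g • jmap p
  jmap_emb : ∀ x : K, jmap (emb x) = (x : St.Tb)

attribute [instance] InducedAssoc.ms InducedAssoc.act

/-! ### Change of basis -/

/-- Changing the basis of the free group: the same tree, with the action precomposed with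
the automorphism `φ` of `F(𝒜)`.  The heart of `St.twist φ` is the heart of `T` with respect
to the basis `φ(𝒜)`. -/
def TreeSetup.twist {ι : Type} (St : TreeSetup ι) (φ : FreeGroup ι ≃* FreeGroup ι) :
    TreeSetup ι where
  Tb := St.Tb
  ms := St.ms
  complete := St.complete
  tree := St.tree
  act := { smul := fun g x => φ g • x
           one_smul := fun x => by show φ 1 • x = x; rw [map_one, one_smul]
           mul_smul := fun g h x => by
             show φ (g * h) • x = φ g • φ h • x
             rw [map_mul, mul_smul] }
  act_isom := fun g => St.act_isom (φ g)
  Tsub := St.Tsub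
  nonempty := St.nonempty
  dense := St.dense
  sub_subtree := St.sub_subtree
  invariant := fun g x hx => St.invariant (φ g) x hx
  minimal := fun A hA hne hsub hinv => St.minimal A hA hne hsub (fun g x hx => by
    have h : φ (φ.symm g) • x ∈ A := hinv (φ.symm g) x hx
    rwa [MulEquiv.apply_symm_apply] at h)
  dense_orbits := fun x hx => by
    have hr : (Set.range fun g : FreeGroup ι => φ g • x) =
        Set.range fun g : FreeGroup ι => g • x := by
      apply Set.ext; intro y
      constructor
      · rintro ⟨g, rfl⟩; exact ⟨φ g, rfl⟩
      · rintro ⟨g, rfl⟩; exact ⟨φ.symm g, by simp⟩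
    show St.Tsub ⊆ closure (Set.range fun g : FreeGroup ι => φ g • x)
    rw [hr]; exact St.dense_orbits x hx
  arc_stab := fun g x hx y hy hxy him => by
    have h1 : φ g = 1 := St.arc_stab (φ g) x hx y hy hxy him
    have h2 := congrArg φ.symm h1
    simpa using h2

/-! ### The boundary `∂T`, the space `T̂ = T̄ ∪ ∂T` and the observers' topology -/

/-- An isometric ray (parametrized on `[0,∞)`) in a metric space. -/
def IsRay {T : Type} [MetricSpace T] (r : ℝ → T) : Prop :=
  ∀ s t : ℝ, 0 ≤ s → 0 ≤ t → dist (r s) (r t) = |s - t|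

/-- The type of isometric rays in `T`. -/
def Ray (T : Type) [MetricSpace T] : Type := {r : ℝ → T // IsRay r}

/-- Two rays define the same end iff they are at bounded distance. -/
def rayEnd (T : Type) [MetricSpace T] : Setoid (Ray T) where
  r := fun r₁ r₂ => ∃ C : ℝ, ∀ t : ℝ, 0 ≤ t → dist (r₁.1 t) (r₂.1 t) ≤ C
  iseqv := by
    refine ⟨fun r => ⟨0, fun t _ => by simp⟩, ?_, ?_⟩
    · rintro r₁ r₂ ⟨C, hC⟩
      exact ⟨C, fun t ht => by rw [dist_comm]; exact hC t ht⟩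
    · rintro r₁ r₂ r₃ ⟨C, hC⟩ ⟨D, hD⟩
      exact ⟨C + D, fun t ht =>
        (dist_triangle _ (r₂.1 t) _).trans (add_le_add (hC t ht) (hD t ht))⟩

/-- The Gromov boundary `∂T`: ends of `T`, i.e. classes of rays at bounded distance. -/
def GromovBoundary (T : Type) [MetricSpace T] : Type := Quotient (rayEnd T)

/-- The space `T̂ = T̄ ∪ ∂T` (for `T` a complete ℝ-tree, representing the completion `T̄`). -/
def TreeHat (T : Type) [MetricSpace T] : Type := T ⊕ GromovBoundary T

/-- The segment `[x, ξ]` from a point `x ∈ T̄` to a boundary point `ξ ∈ ∂T`. -/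
def raySeg {T : Type} [MetricSpace T] (x : T) (ξ : GromovBoundary T) : Set (TreeHat T) :=
  ({Sum.inr ξ} : Set (TreeHat T)) ∪ Sum.inl ''
    {p | ∃ r : Ray T, Quotient.mk (rayEnd T) r = ξ ∧ r.1 0 = x ∧ ∃ t : ℝ, 0 ≤ t ∧ r.1 t = p}

/-- The segment `[ξ, η]` between two boundary points. -/
def lineSeg {T : Type} [MetricSpace T] (ξ η : GromovBoundary T) : Set (TreeHat T) :=
  ({Sum.inr ξ, Sum.inr η} : Set (TreeHat T)) ∪ Sum.inl ''
    {p | ∃ r r' : Ray T, Quotient.mk (rayEnd T) r = ξ ∧ Quotient.mk (rayEnd T) r' = η ∧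
      r.1 0 = p ∧ r'.1 0 = p ∧ ∀ s t : ℝ, 0 ≤ s → 0 ≤ t → dist (r.1 s) (r'.1 t) = s + t}

/-- The segment `[P, Q]` between two points of `T̂ = T̄ ∪ ∂T`. -/
def segHat {T : Type} [MetricSpace T] : TreeHat T → TreeHat T → Set (TreeHat T)
  | Sum.inl x, Sum.inl y => Sum.inl '' seg x y
  | Sum.inl x, Sum.inr ξ => raySeg x ξ
  | Sum.inr ξ, Sum.inl x => raySeg x ξ
  | Sum.inr ξ, Sum.inr η => lineSeg ξ η

/-- The observers' topology on `T̂`: generated by the set of directions, where the direction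
at `P` containing `x` is the set of points `y` with `P ∉ [x,y]` (i.e. the connected component
of `T̂ ∖ {P}` containing `x`). -/
def observersTopology (T : Type) [MetricSpace T] : TopologicalSpace (TreeHat T) :=
  TopologicalSpace.generateFrom
    {D | ∃ P x : TreeHat T, x ≠ P ∧ D = {y | y ≠ P ∧ P ∉ segHat x y}}

/-- The extension to `T̂ = T̄ ∪ ∂T` of an isometric action on `T̄`. -/
def TreeHat.smul {T : Type} [MetricSpace T] {G : Type} [Group G] [MulAction G T]
    (hiso : ∀ g : G, Isometry fun x : T => g • x) (g : G) : TreeHat T → TreeHat T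
  | Sum.inl x => Sum.inl (g • x)
  | Sum.inr ξ => Sum.inr <| Quotient.map'
      (fun r : Ray T => (⟨fun t => g • r.1 t, fun s t hs ht => by
        have h := (hiso g).dist_eq (r.1 s) (r.1 t)
        simpa using h.trans (r.2 s t hs ht)⟩ : Ray T))
      (fun r r' h => by
        obtain ⟨C, hC⟩ := h
        exact ⟨C, fun t ht => by
          have h' := (hiso g).dist_eq (r.1 t) (r'.1 t)
          simpa using h'.le.trans (hC t ht)⟩) ξ

/-! ### Laminations -/

/-- An algebraic lamination (as a set of pairs of boundary points) is closed by diagonal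
leaves. -/
def ClosedByDiagonal {ι : Type} (L : Set (InfWord ι × InfWord ι)) : Prop :=
  ∀ X X' X'' : InfWord ι, (X, X') ∈ L → (X', X'') ∈ L → X = X'' ∨ (X, X'') ∈ L

/-- Invariance of a lamination under the `F(𝒜)`-action on `∂²F(𝒜)`. -/
def InvariantLam {ι : Type} [DecidableEq ι] (L : Set (InfWord ι × InfWord ι)) : Prop :=
  ∀ (w : FreeGroup ι) (X X' Y Y' : InfWord ι), (X, X') ∈ L →
    SmulBoundary w X Y → SmulBoundary w X' Y' → (Y, Y') ∈ L

/-- Invariance of a lamination under the flip map. -/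
def FlipInvariant {ι : Type} (L : Set (InfWord ι × InfWord ι)) : Prop :=
  ∀ X Y : InfWord ι, (X, Y) ∈ L → (Y, X) ∈ L

/-- The dual lamination `L²(T)` is minimal up to diagonal leaves: it contains no proper
non-trivial sublamination that is closed by diagonal leaves. -/
def MinimalUpToDiagonal {ι : Type} [DecidableEq ι] (St : TreeSetup ι) : Prop :=
  ∀ L : Set (InfWord ι × InfWord ι), L ⊆ L2 St → L.Nonempty → IsClosed L →
    InvariantLam L → FlipInvariant L → ClosedByDiagonal L → L = L2 St

end CHL

namespace CHL

section TreeGeometry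

variable {T : Type*} [MetricSpace T]

theorem mem_seg {x y z : T} : z ∈ seg x y ↔ dist x z + dist z y = dist x y := Iff.rfl

theorem seg_comm (x y : T) : seg x y = seg y x := by
  ext z
  rw [mem_seg, mem_seg, dist_comm x z, dist_comm z y, dist_comm x y, add_comm]

theorem left_mem_seg (x y : T) : x ∈ seg x y := by simp [mem_seg]

theorem right_mem_seg (x y : T) : y ∈ seg x y := by simp [mem_seg]

theorem isClosed_seg (x y : T) : IsClosed (seg x y) :=
  isClosed_eq (by fun_prop) (by fun_prop)

theorem dist_le_of_mem_seg {x y z : T} (h : z ∈ seg x y) : dist x z ≤ dist x y := by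
  have := mem_seg.1 h
  linarith [dist_nonneg (x := z) (y := y)]

theorem eq_of_mem_seg_self {x z : T} (h : z ∈ seg x x) : z = x := by
  have := mem_seg.1 h
  rw [dist_self] at this
  exact (dist_le_zero.1 (by linarith [dist_nonneg (x := z) (y := x)] : dist x z ≤ 0)).symm

theorem mem_seg_of_mem_left {x y z w : T} (hz : z ∈ seg x y) (hw : w ∈ seg x z) :
    w ∈ seg x y := by
  have h1 := mem_seg.1 hz
  have h2 := mem_seg.1 hw
  rw [mem_seg]
  linarith [dist_triangle x w y, dist_triangle w z y]

theorem mem_seg_of_mem_left' {x y z w : T} (hz : z ∈ seg x y) (hw : w ∈ seg x z) :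
    z ∈ seg w y := by
  have h1 := mem_seg.1 hz
  have h2 := mem_seg.1 hw
  rw [mem_seg]
  linarith [dist_triangle x w y, dist_triangle w z y]

theorem mem_seg_of_mem_right {x y z w : T} (hz : z ∈ seg x y) (hw : w ∈ seg z y) :
    w ∈ seg x y := by
  rw [seg_comm] at *
  exact mem_seg_of_mem_left hz hw

theorem mem_seg_of_mem_right' {x y z w : T} (hz : z ∈ seg x y) (hw : w ∈ seg z y) :
    z ∈ seg x w := by
  have h1 := mem_seg.1 hz
  have h2 := mem_seg.1 hw
  rw [mem_seg]
  linarith [dist_triangle x w y, dist_triangle x z w]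

theorem seg_smul {G : Type*} [Group G] [MulAction G T]
    (hiso : ∀ g : G, Isometry fun x : T => g • x) {x y z : T} (g : G) :
    g • z ∈ seg (g • x) (g • y) ↔ z ∈ seg x y := by
  rw [mem_seg, mem_seg]
  have h : ∀ a b : T, dist (g • a) (g • b) = dist a b := fun a b => (hiso g).dist_eq a b
  rw [h, h, h]

theorem IsSubtree.inter {A B : Set T} (hA : IsSubtree A) (hB : IsSubtree B) :
    IsSubtree (A ∩ B) :=
  fun x hx y hy _ hz => ⟨hA x hx.1 y hy.1 hz, hB x hx.2 y hy.2 hz⟩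

theorem subset_subtreeHull (S : Set T) : S ⊆ subtreeHull S :=
  fun _ hx _ hA => hA.1 hx

theorem isSubtree_subtreeHull (S : Set T) : IsSubtree (subtreeHull S) :=
  fun x hx y hy _ hz A hA => hA.2 x (hx A hA) y (hy A hA) hz

theorem subtreeHull_subset {S A : Set T} (h : S ⊆ A) (hA : IsSubtree A) : subtreeHull S ⊆ A :=
  fun _ hx => hx A ⟨h, hA⟩

theorem IsSubtree.smul {G : Type*} [Group G] [MulAction G T]
    (hiso : ∀ g : G, Isometry fun x : T => g • x) {A : Set T} (hA : IsSubtree A) (g : G) :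
    IsSubtree (g • A) := by
  rintro _ ⟨x, hx, rfl⟩ _ ⟨y, hy, rfl⟩ z hz
  refine ⟨g⁻¹ • z, hA x hx y hy ?_, by simp⟩
  rw [← seg_smul hiso g]
  simpa using hz

variable [IsRTree T]

theorem four_point_le (x y z w : T) :
    dist x y + dist z w ≤ dist x z + dist y w ∨ dist x y + dist z w ≤ dist x w + dist y z :=
  le_max_iff.1 (IsRTree.four_point x y z w)

theorem exists_mem_seg {x y : T} {t : ℝ} (h0 : 0 ≤ t) (h1 : t ≤ dist x y) :
    ∃ z ∈ seg x y, dist x z = t := by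
  obtain ⟨f, hf0, hf1, hf⟩ := IsRTree.geodesic x y
  have ha : dist x (f t) = t := by
    have := hf 0 ⟨le_rfl, dist_nonneg⟩ t ⟨h0, h1⟩
    rw [hf0] at this
    rw [this, zero_sub, abs_neg, abs_of_nonneg h0]
  have hb : dist (f t) y = dist x y - t := by
    have := hf t ⟨h0, h1⟩ (dist x y) ⟨dist_nonneg, le_rfl⟩
    rw [hf1] at this
    rw [this, abs_sub_comm, abs_of_nonneg (by linarith)]
  exact ⟨f t, by rw [mem_seg]; linarith, ha⟩

theorem eq_of_mem_seg {x y z z' : T} (hz : z ∈ seg x y) (hz' : z' ∈ seg x y)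
    (h : dist x z = dist x z') : z = z' := by
  have h1 := mem_seg.1 hz
  have h2 := mem_seg.1 hz'
  have h3 := dist_comm y z
  have h4 := dist_comm y z'
  refine dist_le_zero.1 ?_
  rcases four_point_le x y z z' with h5 | h5 <;> linarith

theorem seg_split {x y z : T} (hz : z ∈ seg x y) (w : T) : z ∈ seg x w ∨ z ∈ seg w y := by
  have h1 := mem_seg.1 hz
  have h3 := dist_comm y z
  have h4 := dist_comm y w
  have h5 := dist_comm z w
  rcases four_point_le x y z w with h | h
  · right
    rw [mem_seg]
    linarith [dist_triangle w z y]
  · left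
    rw [mem_seg]
    linarith [dist_triangle x z w]

theorem exists_center (x y w : T) : ∃ m, m ∈ seg x y ∧ m ∈ seg x w ∧ m ∈ seg y w := by
  have hyw := dist_comm y w
  have hxy := dist_comm x y
  obtain ⟨m, hm, hmt⟩ := exists_mem_seg (x := x) (y := y)
    (t := (dist x y + dist x w - dist y w) / 2)
    (by linarith [dist_triangle y x w]) (by linarith [dist_triangle x y w])
  have h1 := mem_seg.1 hm
  have hmy := dist_comm m y
  have hmw : dist m w ≤ (dist x w + dist y w - dist x y) / 2 := by
    rcases four_point_le x y m w with h | h <;> linarith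
  refine ⟨m, hm, ?_, ?_⟩ <;> rw [mem_seg] <;>
    linarith [dist_triangle x m w, dist_triangle y m w]

theorem isCompact_seg (x y : T) : IsCompact (seg x y) := by
  obtain ⟨f, hf0, hf1, hf⟩ := IsRTree.geodesic x y
  have hc : IsCompact (f '' Icc 0 (dist x y)) := by
    refine isCompact_Icc.image_of_continuousOn ?_
    refine LipschitzOnWith.continuousOn (K := 1) (LipschitzOnWith.of_dist_le_mul ?_)
    intro s hs t ht
    rw [hf s hs t ht, Real.dist_eq]
    simp
  refine hc.of_isClosed_subset (isClosed_seg x y) fun z hz => ?_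
  have hle := dist_le_of_mem_seg hz
  have ha := hf 0 ⟨le_rfl, dist_nonneg⟩ (dist x z) ⟨dist_nonneg, hle⟩
  have hb := hf (dist x z) ⟨dist_nonneg, hle⟩ (dist x y) ⟨dist_nonneg, le_rfl⟩
  rw [hf0, zero_sub, abs_neg, abs_of_nonneg dist_nonneg] at ha
  rw [hf1, abs_sub_comm, abs_of_nonneg (by linarith)] at hb
  exact ⟨dist x z, ⟨dist_nonneg, hle⟩,
    eq_of_mem_seg (x := x) (y := y) (by rw [mem_seg]; linarith) hz ha⟩

theorem isSubtree_closedBall (p : T) (r : ℝ) : IsSubtree (Metric.closedBall p r) := by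
  intro x hx y hy z hz
  rw [Metric.mem_closedBall'] at *
  rcases seg_split hz p with h | h
  · exact (dist_le_of_mem_seg (seg_comm x p ▸ h)).trans hx
  · exact (dist_le_of_mem_seg h).trans hy

theorem isSubtree_iUnion_seg (p : T) (S : Set T) : IsSubtree (⋃ f ∈ S, seg p f) := by
  intro x hx y hy z hz
  simp only [mem_iUnion, exists_prop] at *
  obtain ⟨f, hf, hxf⟩ := hx
  obtain ⟨f', hf', hyf⟩ := hy
  rcases seg_split hz p with h | h
  · exact ⟨f, hf, mem_seg_of_mem_left hxf (seg_comm x p ▸ h)⟩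
  · exact ⟨f', hf', mem_seg_of_mem_left hyf h⟩

theorem subtreeHull_eq_iUnion_seg {p : T} {S : Set T} (hp : p ∈ S) :
    subtreeHull S = ⋃ f ∈ S, seg p f := by
  refine (subtreeHull_subset ?_ (isSubtree_iUnion_seg p S)).antisymm ?_
  · exact fun f hf => mem_biUnion hf (right_mem_seg p f)
  · refine iUnion₂_subset fun f hf => ?_
    exact isSubtree_subtreeHull S p (subset_subtreeHull S hp) f (subset_subtreeHull S hf)

theorem isCompact_subtreeHull (F : Finset T) : IsCompact (subtreeHull (F : Set T)) := by
  rcases F.eq_empty_or_nonempty with rfl | ⟨p, hp⟩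
  · rw [Finset.coe_empty, subset_empty_iff.1 (subtreeHull_subset (S := (∅ : Set T)) subset_rfl
      (fun x hx => hx.elim))]
    exact isCompact_empty
  · rw [subtreeHull_eq_iUnion_seg (Finset.mem_coe.2 hp)]
    exact F.finite_toSet.isCompact_biUnion fun f _ => isCompact_seg p f

theorem exists_gate {A : Set T} (hA : IsCompact A) (hne : A.Nonempty) (hs : IsSubtree A) (x : T) :
    ∃ q ∈ A, ∀ a ∈ A, q ∈ seg x a := by
  obtain ⟨q, hq, hmin⟩ := hA.exists_isMinOn hne
    (f := fun a => dist x a) (by fun_prop)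
  refine ⟨q, hq, fun a ha => ?_⟩
  obtain ⟨m, h1, h2, h3⟩ := exists_center x q a
  have hm : dist x q ≤ dist x m := hmin (hs q hq a ha h3)
  have hle := dist_le_of_mem_seg h1
  rwa [← eq_of_mem_seg h1 (right_mem_seg x q) (le_antisymm hle hm)]

theorem IsSubtree.isRTree {A : Set T} (hA : IsSubtree A) : IsRTree A where
  geodesic x y := by
    obtain ⟨f, hf0, hf1, hf⟩ := IsRTree.geodesic (x : T) (y : T)
    have hmem : ∀ t ∈ Icc (0 : ℝ) (dist (x : T) y), f t ∈ A := by
      intro t ht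
      have ha := hf 0 ⟨le_rfl, dist_nonneg⟩ t ht
      have hb := hf t ht (dist (x : T) y) ⟨dist_nonneg, le_rfl⟩
      rw [hf0, zero_sub, abs_neg, abs_of_nonneg ht.1] at ha
      rw [hf1, abs_sub_comm, abs_of_nonneg (by linarith [ht.2])] at hb
      exact hA x x.2 y y.2 (by rw [mem_seg]; linarith)
    classical
    refine ⟨fun t => if h : t ∈ Icc (0 : ℝ) (dist (x : T) y) then ⟨f t, hmem t h⟩ else x,
      ?_, ?_, ?_⟩
    · simp [hf0, dist_nonneg]
    · have : dist x y ∈ Icc (0 : ℝ) (dist (x : T) y) := ⟨dist_nonneg, le_rfl⟩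
      simp only [this, dif_pos]
      exact Subtype.ext hf1
    · intro s hs t ht
      have hs' : s ∈ Icc (0 : ℝ) (dist (x : T) y) := hs
      have ht' : t ∈ Icc (0 : ℝ) (dist (x : T) y) := ht
      simp only [hs', ht', dif_pos]
      exact hf s hs' t ht'
  four_point x y z w := IsRTree.four_point (x : T) y z w

section TranslationLength

variable {G : Type*} [Group G] [MulAction G T]

theorem dist_sub_dist_le_dist_smul (hiso : ∀ g : G, Isometry fun x : T => g • x) (g : G)
    (p x : T) : dist p (g ^ 2 • p) - dist p (g • p) ≤ dist x (g • x) := by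
  have hd : ∀ (a b : T), dist (g • a) (g • b) = dist a b := fun a b => (hiso g).dist_eq a b
  rw [pow_two, mul_smul]
  have h1 := hd p (g • p)
  have h2 := hd p x
  have h3 := hd (g • p) x
  have h4 := hd x (g • x)
  have h5 := dist_comm (g • g • p) (g • p)
  have h6 := dist_comm (g • p) x
  rcases four_point_le p (g • g • p) (g • p) (g • x) with h | h
  · linarith [dist_triangle (g • p) (g • x) x, dist_comm (g • x) x]
  · linarith [dist_triangle p x (g • x), dist_comm p x]

theorem exists_dist_smul_le (hiso : ∀ g : G, Isometry fun x : T => g • x) (g : G) (p : T) :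
    ∃ m ∈ seg p (g • p), dist m (g • m) ≤ max 0 (dist p (g ^ 2 • p) - dist p (g • p)) := by
  have hd : ∀ (a b : T), dist (g • a) (g • b) = dist a b := fun a b => (hiso g).dist_eq a b
  obtain ⟨m, hm, hmt⟩ := exists_mem_seg (x := p) (y := g • p) (t := dist p (g • p) / 2)
    (by positivity) (by linarith [dist_nonneg (x := p) (y := g • p)])
  refine ⟨m, hm, ?_⟩
  rw [pow_two, mul_smul]
  have h0 := mem_seg.1 hm
  have h1 := hd p (g • p)
  have h2 := hd p m
  have h3 := hd m (g • p)
  have c1 := dist_comm (g • m) (g • p)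
  have c2 := dist_comm (g • m) p
  have c3 := dist_comm p m
  have c4 := dist_comm p (g • p)
  have hb : dist p (g • m) - dist p (g • p) / 2
      ≤ max 0 (dist p (g • g • p) - dist p (g • p)) := by
    rw [le_max_iff]
    rcases four_point_le (g • m) p (g • p) (g • g • p) with h | h
    · right; linarith
    · left; linarith
  rcases four_point_le m (g • m) (g • p) p with h | h
  · linarith
  · exact le_max_of_le_left (by linarith)

theorem translationLengthOn_eq (hiso : ∀ g : G, Isometry fun x : T => g • x) {A : Set T}
    (hA : IsSubtree A) (g : G) {p : T} (hp : p ∈ A) (hgp : g • p ∈ A) :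
    translationLengthOn A g = max 0 (dist p (g ^ 2 • p) - dist p (g • p)) := by
  obtain ⟨m, hm, hle⟩ := exists_dist_smul_le hiso g p
  have : Nonempty A := ⟨⟨p, hp⟩⟩
  refine le_antisymm ?_ ?_
  · refine (ciInf_le ⟨0, ?_⟩ (⟨m, hA p hp _ hgp hm⟩ : A)).trans hle
    rintro _ ⟨x, rfl⟩
    exact dist_nonneg
  · exact le_ciInf fun x => max_le dist_nonneg (dist_sub_dist_le_dist_smul hiso g p x)

theorem translationLength_eq (hiso : ∀ g : G, Isometry fun x : T => g • x) (g : G) (p : T) :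
    translationLength G T g = max 0 (dist p (g ^ 2 • p) - dist p (g • p)) := by
  obtain ⟨m, -, hle⟩ := exists_dist_smul_le hiso g p
  have : Nonempty T := ⟨p⟩
  refine le_antisymm ?_ ?_
  · refine (ciInf_le ⟨0, ?_⟩ m).trans hle
    rintro _ ⟨x, rfl⟩
    exact dist_nonneg
  · exact le_ciInf fun x => max_le dist_nonneg (dist_sub_dist_le_dist_smul hiso g p x)

end TranslationLength

end TreeGeometry

end CHL

namespace CHL

section Words

variable {ι : Type*}

/-- The inverse of a letter of `𝒜^{±1}`. -/
def invLetter (z : ι × Bool) : ι × Bool := (z.1, !z.2)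

@[simp] theorem invLetter_invLetter (z : ι × Bool) : invLetter (invLetter z) = z := by
  simp [invLetter]

/-- A letter of `𝒜^{±1}` as an element of the free group. -/
def letterElt (z : ι × Bool) : FreeGroup ι := FreeGroup.mk [z]

theorem letterElt_invLetter (z : ι × Bool) : letterElt (invLetter z) = (letterElt z)⁻¹ := rfl

theorem ne_invLetter_iff {a b : ι × Bool} : b ≠ invLetter a ↔ (a.1 = b.1 → a.2 = b.2) := by
  obtain ⟨a1, a2⟩ := a
  obtain ⟨b1, b2⟩ := b
  cases a2 <;> cases b2 <;> simp [invLetter, eq_comm]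

theorem invRev_cons (z : ι × Bool) (l : List (ι × Bool)) :
    FreeGroup.invRev (z :: l) = FreeGroup.invRev l ++ [invLetter z] := by
  simp [FreeGroup.invRev, invLetter]

theorem mk_cons (z : ι × Bool) (l : List (ι × Bool)) :
    FreeGroup.mk (z :: l) = letterElt z * FreeGroup.mk l := by
  simp [letterElt, FreeGroup.mul_mk]

theorem mk_append_singleton (z : ι × Bool) (l : List (ι × Bool)) :
    FreeGroup.mk (l ++ [z]) = FreeGroup.mk l * letterElt z := by
  simp [letterElt, FreeGroup.mul_mk]

theorem isReduced_append_iff {l l' : List (ι × Bool)} : FreeGroup.IsReduced (l ++ l') ↔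
    FreeGroup.IsReduced l ∧ FreeGroup.IsReduced l' ∧
      ∀ a ∈ l.getLast?, ∀ b ∈ l'.head?, b ≠ invLetter a := by
  simp only [FreeGroup.IsReduced, List.isChain_append, ne_invLetter_iff]

variable [DecidableEq ι]

theorem toWord_mk_of_isReduced {l : List (ι × Bool)} (h : FreeGroup.IsReduced l) :
    (FreeGroup.mk l).toWord = l := by
  rw [FreeGroup.toWord_mk, h.reduce_eq]

theorem toWord_mul_letterElt (w : FreeGroup ι) (z : ι × Bool) :
    (w * letterElt z).toWord = w.toWord ++ [z] ∨
      w.toWord = (w * letterElt z).toWord ++ [invLetter z] := by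
  rcases List.eq_nil_or_concat' w.toWord with h | ⟨l, t, h⟩
  · left
    rw [FreeGroup.toWord_eq_nil_iff] at h
    simp [h, letterElt]
  · have hr : FreeGroup.IsReduced (l ++ [t]) := h ▸ FreeGroup.isReduced_toWord
    have hw : w = FreeGroup.mk (l ++ [t]) := by rw [← h, FreeGroup.mk_toWord]
    by_cases hz : z = invLetter t
    · right
      have : w * letterElt z = FreeGroup.mk l := by
        rw [hw, hz, mk_append_singleton, letterElt_invLetter, mul_inv_cancel_right]
      rw [this, h, hz, invLetter_invLetter,
        toWord_mk_of_isReduced (isReduced_append_iff.1 hr).1]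
    · left
      rw [h, hw, ← mk_append_singleton]
      refine toWord_mk_of_isReduced (isReduced_append_iff.2 ⟨hr, ?_, ?_⟩)
      · exact List.isChain_singleton z
      · simpa using hz

theorem toWord_inv_mul_append {h v : FreeGroup ι} {l : List (ι × Bool)} {z : ι × Bool}
    (hv : v.toWord = l ++ [z]) (hne : h ≠ v) (hle : h.norm ≤ v.norm) :
    (h⁻¹ * v).toWord = (h⁻¹ * FreeGroup.mk l).toWord ++ [z] := by
  have hvl : FreeGroup.mk l * letterElt z = v := by
    rw [← mk_append_singleton, ← hv, FreeGroup.mk_toWord]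
  have hvv : h⁻¹ * v = h⁻¹ * FreeGroup.mk l * letterElt z := by rw [mul_assoc, hvl]
  rcases toWord_mul_letterElt (h⁻¹ * FreeGroup.mk l) z with h1 | h1
  · rw [hvv, h1]
  · exfalso
    rw [← hvv] at h1
    have hr : FreeGroup.IsReduced ((h⁻¹ * v).toWord ++ v⁻¹.toWord) := by
      refine isReduced_append_iff.2 ⟨FreeGroup.isReduced_toWord, FreeGroup.isReduced_toWord, ?_⟩
      intro a ha b hb
      have hra : FreeGroup.IsReduced ((h⁻¹ * v).toWord ++ [invLetter z]) :=
        h1 ▸ FreeGroup.isReduced_toWord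
      have := (isReduced_append_iff.1 hra).2.2 a ha (invLetter z) (by simp)
      rw [FreeGroup.toWord_inv, hv] at hb
      have hb' : b = invLetter z := by
        simpa [FreeGroup.invRev, invLetter, eq_comm] using hb
      rwa [hb']
    have h2 : h⁻¹.toWord = (h⁻¹ * v).toWord ++ v⁻¹.toWord := by
      rw [← toWord_mk_of_isReduced hr, ← FreeGroup.mul_mk, FreeGroup.mk_toWord,
        FreeGroup.mk_toWord, mul_inv_cancel_right]
    have h3 := congrArg List.length h2
    rw [List.length_append] at h3
    have h4 : h⁻¹.toWord.length = h.norm := FreeGroup.norm_inv_eq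
    have h5 : v⁻¹.toWord.length = v.norm := FreeGroup.norm_inv_eq
    have h6 : (h⁻¹ * v).toWord.length = 0 := by lia
    rw [List.length_eq_zero_iff, FreeGroup.toWord_eq_nil_iff, inv_mul_eq_one] at h6
    exact hne h6

theorem head?_toWord_mul_letterElt {w : FreeGroup ι} {z : ι × Bool} (h1 : w ≠ 1)
    (h2 : w * letterElt z ≠ 1) : (w * letterElt z).toWord.head? = w.toWord.head? := by
  rw [Ne, ← FreeGroup.toWord_eq_nil_iff] at h1 h2
  rcases toWord_mul_letterElt w z with h | h
  · rw [h, List.head?_append_of_ne_nil _ h1]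
  · conv_rhs => rw [h]
    rw [List.head?_append_of_ne_nil _ h2]

end Words

end CHL

namespace CHL

/-- The three permuted forms of the four-point condition. -/
def FourPt {X : Type*} (d : X → X → ℝ) (a b c e : X) : Prop :=
  d a b + d c e ≤ max (d a c + d b e) (d a e + d b c) ∧
  d a c + d b e ≤ max (d a b + d c e) (d a e + d b c) ∧
  d a e + d b c ≤ max (d a b + d c e) (d a c + d b e)

namespace FourPt

variable {X : Type*} {d : X → X → ℝ} {a b c e : X}

theorem swap₁ (hd : ∀ x y, d x y = d y x) (h : FourPt d a b c e) : FourPt d b a c e := by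
  obtain ⟨h1, h2, h3⟩ := h
  rw [FourPt, hd b a]
  refine ⟨?_, ?_, ?_⟩
  · simpa only [max_comm, add_comm] using h1
  · simpa only [max_comm, add_comm] using h3
  · simpa only [max_comm, add_comm] using h2

theorem swap₂ (hd : ∀ x y, d x y = d y x) (h : FourPt d a b c e) : FourPt d a c b e := by
  obtain ⟨h1, h2, h3⟩ := h
  rw [FourPt, hd c b]
  exact ⟨h2, h1, by rwa [max_comm]⟩

theorem swap₃ (hd : ∀ x y, d x y = d y x) (h : FourPt d a b c e) : FourPt d a b e c := by
  obtain ⟨h1, h2, h3⟩ := h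
  rw [FourPt, hd e c]
  exact ⟨by rwa [max_comm], h3, h2⟩

end FourPt

theorem fourPt_dist {T : Type*} [MetricSpace T] [IsRTree T] (a b c e : T) :
    FourPt dist a b c e := by
  refine ⟨IsRTree.four_point a b c e, ?_, ?_⟩
  · have := IsRTree.four_point a c b e
    rwa [dist_comm c b] at this
  · have := IsRTree.four_point a e b c
    rwa [dist_comm e c, dist_comm e b] at this

/-- The data needed to glue copies of `K` along the Cayley tree of the free group: for each letter
`z`, the projection of `K` to the domain of the partial isometry of `z` composed with this partial
isometry, and the distance to the domain. -/
structure Gluing (ι : Type*) (K : Type*) [MetricSpace K] where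
  proj : ι × Bool → K → K
  cost : ι × Bool → K → ℝ
  shift : ∀ z x y,
    cost z x + dist (proj z x) y = dist x (proj (invLetter z) y) + cost (invLetter z) y
  alt : ∀ z x y, proj z x = proj z y ∨
    dist x y = cost z x + cost z y + dist (proj z x) (proj z y)
  dist_le : ∀ z x y, dist x y ≤ cost z x + cost z y + dist (proj z x) (proj z y)
  cost_proj : ∀ z x, cost (invLetter z) (proj z x) = 0

namespace Gluing

variable {ι K : Type*} [MetricSpace K] (𝒢 : Gluing ι K)

/-- The distance from a point `x` of the initial copy to a point `y` of the final copy of `K` in the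
chain of copies of `K` described by a word. -/
def pathDist : List (ι × Bool) → K → K → ℝ
  | [], x, y => dist x y
  | z :: l, x, y => 𝒢.cost z x + pathDist l (𝒢.proj z x) y

theorem pathDist_append_singleton (l : List (ι × Bool)) (z : ι × Bool) (x y : K) :
    𝒢.pathDist (l ++ [z]) x y =
      𝒢.pathDist l x (𝒢.proj (invLetter z) y) + 𝒢.cost (invLetter z) y := by
  induction l generalizing x with
  | nil => exact 𝒢.shift z x y
  | cons a l ih => simp only [List.cons_append, pathDist, ih, add_assoc]

theorem pathDist_invRev (l : List (ι × Bool)) (x y : K) :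
    𝒢.pathDist (FreeGroup.invRev l) y x = 𝒢.pathDist l x y := by
  induction l generalizing x with
  | nil => exact dist_comm y x
  | cons z l ih =>
    rw [invRev_cons, pathDist_append_singleton, invLetter_invLetter, ih, pathDist, add_comm]

theorem exists_pathDist_eq (l : List (ι × Bool)) (x : K) :
    ∃ q, ∀ y, 𝒢.pathDist l x y = 𝒢.pathDist l x q + dist q y := by
  induction l generalizing x with
  | nil => exact ⟨x, fun y => by simp [pathDist]⟩
  | cons z l ih =>
    obtain ⟨q, hq⟩ := ih (𝒢.proj z x)
    exact ⟨q, fun y => by simp only [pathDist, hq y, add_assoc]⟩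

variable [DecidableEq ι]

/-- The distance between two points of the disjoint union of the copies `{g} × K`. -/
def preDist (P Q : FreeGroup ι × K) : ℝ := 𝒢.pathDist (P.1⁻¹ * Q.1).toWord P.2 Q.2

theorem preDist_comm (P Q : FreeGroup ι × K) : 𝒢.preDist P Q = 𝒢.preDist Q P := by
  rw [preDist, preDist, ← pathDist_invRev, ← FreeGroup.toWord_inv, mul_inv_rev, inv_inv]

theorem preDist_mk_mk (g : FreeGroup ι) (x y : K) : 𝒢.preDist (g, x) (g, y) = dist x y := by
  simp [preDist, pathDist]

theorem preDist_self (P : FreeGroup ι × K) : 𝒢.preDist P P = 0 := by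
  rw [← dist_self P.2]; exact 𝒢.preDist_mk_mk P.1 P.2 P.2

theorem exists_preDist_eq (P : FreeGroup ι × K) (g : FreeGroup ι) :
    ∃ q, ∀ y, 𝒢.preDist P (g, y) = 𝒢.preDist P (g, q) + dist q y :=
  𝒢.exists_pathDist_eq (P.1⁻¹ * g).toWord P.2

theorem preDist_of_toWord_eq {h v : FreeGroup ι} {l : List (ι × Bool)} {z : ι × Bool}
    (hv : v.toWord = l ++ [z]) (hne : h ≠ v) (hle : h.norm ≤ v.norm) (x y : K) :
    𝒢.preDist (h, y) (v, x) =
      𝒢.preDist (h, y) (FreeGroup.mk l, 𝒢.proj (invLetter z) x) + 𝒢.cost (invLetter z) x := by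
  simp only [preDist]
  rw [toWord_inv_mul_append hv hne hle, pathDist_append_singleton]

/-- The four-point condition for points whose copies of `K` are reduced by pushing the points of a
fixed copy to a neighbouring copy. -/
theorem fourPt_of_push {X : Type*} {d : X → X → ℝ} (hd : ∀ x y, d x y = d y x)
    (h0 : ∀ x, d x x = 0) {leaf : X → Prop} {φ : X → X} {κ : X → ℝ}
    (hleaf : ∀ x y, leaf x → leaf y → φ x = φ y ∨ d x y = κ x + κ y + d (φ x) (φ y))
    (hle : ∀ x y, leaf x → leaf y → d x y ≤ κ x + κ y + d (φ x) (φ y))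
    (hend : ∀ x a b c, leaf a → leaf b → leaf c → FourPt d a b c x)
    {S : X → Prop}
    (hne : ∀ x y, S x → S y → ¬ leaf x → d x y = κ x + κ y + d (φ x) (φ y))
    {a b c e : X} (ha : S a) (hb : S b) (hc : S c) (he : S e)
    (h : FourPt d (φ a) (φ b) (φ c) (φ e)) : FourPt d a b c e := by
  have key : ∀ a b c e : X, S a → S b → S c → S e → FourPt d (φ a) (φ b) (φ c) (φ e) →
      ¬ leaf c → ¬ leaf e → FourPt d a b c e := by
    intro a b c e ha hb hc he h hlc hle'
    have e1 := hne c e hc he hlc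
    have e2 := hne c a hc ha hlc
    have e3 := hne c b hc hb hlc
    have e4 := hne e a he ha hle'
    have e5 := hne e b he hb hle'
    rw [hd c a, hd (φ c)] at e2
    rw [hd c b, hd (φ c)] at e3
    rw [hd e a, hd (φ e)] at e4
    rw [hd e b, hd (φ e)] at e5
    obtain ⟨h1, h2, h3⟩ := h
    by_cases hE : d a b = κ a + κ b + d (φ a) (φ b)
    · rw [FourPt, e1, e2, e3, e4, e5, hE]
      rw [le_max_iff] at h1 h2 h3
      refine ⟨?_, ?_, ?_⟩ <;> rw [le_max_iff]
      · exact h1.imp (fun h => by linarith) fun h => by linarith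
      · exact h2.imp (fun h => by linarith) fun h => by linarith
      · exact h3.imp (fun h => by linarith) fun h => by linarith
    · have hla : leaf a := by
        by_contra hla
        exact hE (hne a b ha hb hla)
      have hlb : leaf b := by
        by_contra hlb
        apply hE
        rw [hd a b, hne b a hb ha hlb, hd (φ b)]
        ring
      have hφ : φ a = φ b := (hleaf a b hla hlb).resolve_right hE
      have hab := hle a b hla hlb
      rw [hφ] at hab h1 e2 e4
      rw [h0] at hab h1
      rw [FourPt, e1, e2, e3, e4, e5]
      rw [le_max_iff] at h1
      refine ⟨?_, ?_, ?_⟩ <;> rw [le_max_iff]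
      · rcases h1 with h1 | h1
        · left; linarith
        · left; linarith
      · right; linarith
      · right; linarith
  by_cases la : leaf a <;> by_cases lb : leaf b <;> by_cases lc : leaf c <;> by_cases le : leaf e
  · exact hend e a b c la lb lc
  · exact hend e a b c la lb lc
  · exact (hend c a b e la lb le).swap₃ hd
  · exact key a b c e ha hb hc he h lc le
  · exact ((hend b a c e la lc le).swap₃ hd).swap₂ hd
  · exact (key a c b e ha hc hb he (h.swap₂ hd) lb le).swap₂ hd
  · exact ((key a e b c ha he hb hc ((h.swap₃ hd).swap₂ hd) lb lc).swap₂ hd).swap₃ hd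
  · exact key a b c e ha hb hc he h lc le
  · exact (((hend a b c e lb lc le).swap₃ hd).swap₂ hd).swap₁ hd
  · exact ((key b c a e hb hc ha he ((h.swap₁ hd).swap₂ hd) la le).swap₂ hd).swap₁ hd
  · exact (((key b e a c hb he ha hc (((h.swap₁ hd).swap₃ hd).swap₂ hd) la lc).swap₂
      hd).swap₃ hd).swap₁ hd
  · exact key a b c e ha hb hc he h lc le
  · exact ((((key c e a b hc he ha hb ((((h.swap₂ hd).swap₁ hd).swap₃ hd).swap₂ hd)
      la lb).swap₂ hd).swap₃ hd).swap₁ hd).swap₂ hd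
  · exact ((key b c a e hb hc ha he ((h.swap₁ hd).swap₂ hd) la le).swap₂ hd).swap₁ hd
  · exact (((key b e a c hb he ha hc (((h.swap₁ hd).swap₃ hd).swap₂ hd) la lc).swap₂
      hd).swap₃ hd).swap₁ hd
  · exact key a b c e ha hb hc he h lc le

theorem fourPt_preDist [IsRTree K] (P₁ P₂ P₃ P₄ : FreeGroup ι × K) :
    FourPt 𝒢.preDist P₁ P₂ P₃ P₄ := by
  induction hn : P₁.1.norm + P₂.1.norm + P₃.1.norm + P₄.1.norm
    using Nat.strong_induction_on generalizing P₁ P₂ P₃ P₄ with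
  | _ n ih =>
  obtain ⟨v, hv, hmax⟩ := Finset.exists_max_image ({P₁.1, P₂.1, P₃.1, P₄.1} : Finset (FreeGroup ι))
    FreeGroup.norm ⟨_, Finset.mem_insert_self _ _⟩
  have m1 := hmax P₁.1 (by simp)
  have m2 := hmax P₂.1 (by simp)
  have m3 := hmax P₃.1 (by simp)
  have m4 := hmax P₄.1 (by simp)
  have hfib : ∀ (g : FreeGroup ι) (x y z w : K),
      FourPt 𝒢.preDist (g, x) (g, y) (g, z) (g, w) := by
    intro g x y z w
    simp only [FourPt, preDist_mk_mk]
    exact fourPt_dist x y z w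
  rcases List.eq_nil_or_concat' v.toWord with h | ⟨l, z, hvl⟩
  · have hv0 : v.norm = 0 := by rw [FreeGroup.norm, h, List.length_nil]
    have hz : ∀ P : FreeGroup ι × K, P.1.norm ≤ v.norm → P = (1, P.2) := fun P hP =>
      Prod.ext (FreeGroup.norm_eq_zero.1 (by lia)) rfl
    rw [hz P₁ m1, hz P₂ m2, hz P₃ m3, hz P₄ m4]
    exact hfib _ _ _ _ _
  · have hlr : FreeGroup.IsReduced l :=
      (isReduced_append_iff.1 (hvl ▸ FreeGroup.isReduced_toWord)).1
    have hnl : (FreeGroup.mk l).norm + 1 = v.norm := by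
      rw [FreeGroup.norm, FreeGroup.norm, hvl, toWord_mk_of_isReduced hlr]
      simp
    set φ : FreeGroup ι × K → FreeGroup ι × K := fun P =>
      if P.1 = v then (FreeGroup.mk l, 𝒢.proj (invLetter z) P.2) else P with hφ
    set κ : FreeGroup ι × K → ℝ := fun P =>
      if P.1 = v then 𝒢.cost (invLetter z) P.2 else 0 with hκ
    have hφle : ∀ P, (φ P).1.norm ≤ P.1.norm := by
      intro P
      by_cases h : P.1 = v
      · simp only [hφ, h, if_true]; lia
      · simp only [hφ, h, if_false]; exact le_rfl
    have hφlt : ∀ P, P.1 = v → (φ P).1.norm < P.1.norm := by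
      intro P h
      simp only [hφ, h, if_true]; lia
    have hlt : (φ P₁).1.norm + (φ P₂).1.norm + (φ P₃).1.norm + (φ P₄).1.norm < n := by
      have l1 := hφle P₁
      have l2 := hφle P₂
      have l3 := hφle P₃
      have l4 := hφle P₄
      simp only [Finset.mem_insert, Finset.mem_singleton] at hv
      rcases hv with h | h | h | h
      · have := hφlt P₁ h.symm; lia
      · have := hφlt P₂ h.symm; lia
      · have := hφlt P₃ h.symm; lia
      · have := hφlt P₄ h.symm; lia
    refine fourPt_of_push 𝒢.preDist_comm 𝒢.preDist_self (leaf := fun P => P.1 = v)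
      (φ := φ) (κ := κ) ?_ ?_ ?_ (S := fun P => P.1.norm ≤ v.norm) ?_ m1 m2 m3 m4
      (ih _ hlt _ _ _ _ rfl)
    · rintro ⟨g, x⟩ ⟨g', y⟩ rfl h'
      obtain rfl : g' = g := h'
      simp only [hφ, hκ, if_true, preDist_mk_mk]
      exact (𝒢.alt (invLetter z) x y).imp (fun h => by rw [h]) id
    · rintro ⟨g, x⟩ ⟨g', y⟩ rfl h'
      obtain rfl : g' = g := h'
      simp only [hφ, hκ, if_true, preDist_mk_mk]
      exact 𝒢.dist_le (invLetter z) x y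
    · rintro P ⟨g1, x1⟩ ⟨g2, x2⟩ ⟨g3, x3⟩ h1 h2 h3
      obtain rfl : g1 = v := h1
      obtain rfl : g2 = g1 := h2
      obtain rfl : g3 = g2 := h3
      obtain ⟨q, hq⟩ := 𝒢.exists_preDist_eq P g3
      have h := hfib g3 x1 x2 x3 q
      have e1 := 𝒢.preDist_comm P (g3, x1)
      have e2 := 𝒢.preDist_comm P (g3, x2)
      have e3 := 𝒢.preDist_comm P (g3, x3)
      rw [hq, dist_comm q] at e1 e2 e3
      simp only [FourPt, preDist_mk_mk, ← e1, ← e2, ← e3] at h ⊢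
      obtain ⟨h1, h2, h3⟩ := h
      rw [le_max_iff] at h1 h2 h3
      refine ⟨?_, ?_, ?_⟩ <;> rw [le_max_iff]
      · exact h1.imp (fun h => by linarith) fun h => by linarith
      · exact h2.imp (fun h => by linarith) fun h => by linarith
      · exact h3.imp (fun h => by linarith) fun h => by linarith
    · rintro ⟨h, y⟩ ⟨g, x⟩ hh hg hn
      have hn' : h ≠ v := hn
      by_cases hgv : g = v
      · simp only [hφ, hκ, hn', hgv, if_true, if_false, zero_add]
        rw [𝒢.preDist_of_toWord_eq hvl hn' hh, add_comm]
      · simp only [hφ, hκ, hn', hgv, if_false, zero_add]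

end Gluing

end CHL

namespace CHL

namespace Gluing

variable {ι K : Type*} [MetricSpace K]

/-- The disjoint union of the copies `{g} × K`. -/
def Pt (_ : Gluing ι K) : Type _ := FreeGroup ι × K

theorem dist_proj_proj (𝒢 : Gluing ι K) (z : ι × Bool) (x : K) :
    dist x (𝒢.proj (invLetter z) (𝒢.proj z x)) = 𝒢.cost z x := by
  have h := 𝒢.shift z x (𝒢.proj z x)
  rw [dist_self, 𝒢.cost_proj] at h
  linarith

theorem dist_smul_le_pathDist {T' : Type*} [MetricSpace T'] [MulAction (FreeGroup ι) T']
    (𝒢 : Gluing ι K) (hiso : ∀ g : FreeGroup ι, Isometry fun x : T' => g • x)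
    {e' : K → T'} (he : Isometry e')
    (hc : ∀ z x, 𝒢.cost z x = 0 → (letterElt z)⁻¹ • e' x = e' (𝒢.proj z x))
    (l : List (ι × Bool)) (x y : K) : dist (e' x) (FreeGroup.mk l • e' y) ≤ 𝒢.pathDist l x y := by
  induction l generalizing x with
  | nil =>
    rw [← FreeGroup.one_eq_mk, one_smul, he.dist_eq]
    rfl
  | cons z l ih =>
    have h1 : e' (𝒢.proj (invLetter z) (𝒢.proj z x)) = letterElt z • e' (𝒢.proj z x) := by
      rw [← hc _ _ (𝒢.cost_proj z x), letterElt_invLetter, inv_inv]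
    have h2 := dist_triangle (e' x) (letterElt z • e' (𝒢.proj z x)) (FreeGroup.mk (z :: l) • e' y)
    rw [← h1, he.dist_eq, dist_proj_proj, h1, mk_cons, mul_smul] at h2
    rw [mk_cons, mul_smul]
    refine h2.trans (add_le_add le_rfl ?_)
    exact ((hiso (letterElt z)).dist_eq _ _).le.trans (ih _)

variable [DecidableEq ι] [IsRTree K] (𝒢 : Gluing ι K)

instance : PseudoMetricSpace 𝒢.Pt where
  dist := 𝒢.preDist
  dist_self := 𝒢.preDist_self
  dist_comm := 𝒢.preDist_comm
  dist_triangle P Q R := by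
    have h := (𝒢.fourPt_preDist P R Q Q).1
    have h0 : 𝒢.preDist Q Q = 0 := 𝒢.preDist_self Q
    have h1 : 𝒢.preDist R Q = 𝒢.preDist Q R := 𝒢.preDist_comm R Q
    rw [max_self] at h
    linarith

instance : MulAction (FreeGroup ι) 𝒢.Pt where
  smul g P := (g * P.1, P.2)
  one_smul P := Prod.ext (one_mul P.1) rfl
  mul_smul g h P := Prod.ext (mul_assoc g h P.1) rfl

instance : IsIsometricSMul (FreeGroup ι) 𝒢.Pt where
  isometry_smul g := Isometry.of_dist_eq fun P Q => by
    change 𝒢.pathDist ((g * P.1)⁻¹ * (g * Q.1)).toWord P.2 Q.2 =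
      𝒢.pathDist (P.1⁻¹ * Q.1).toWord P.2 Q.2
    rw [mul_inv_rev, mul_assoc, inv_mul_cancel_left]

/-- The tree obtained by gluing copies of `K` along the Cayley tree of the free group. -/
abbrev Tree : Type _ := SeparationQuotient 𝒢.Pt

/-- The point of the glued tree represented by the point `x` of the copy `{g} × K`. -/
def pt (g : FreeGroup ι) (x : K) : 𝒢.Tree := SeparationQuotient.mk ((g, x) : FreeGroup ι × K)

theorem exists_eq_pt (X : 𝒢.Tree) : ∃ g x, X = 𝒢.pt g x := by
  obtain ⟨⟨g, x⟩, rfl⟩ := SeparationQuotient.surjective_mk X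
  exact ⟨g, x, rfl⟩

theorem smul_pt (g h : FreeGroup ι) (x : K) : g • 𝒢.pt h x = 𝒢.pt (g * h) x := rfl

theorem dist_pt (g h : FreeGroup ι) (x y : K) :
    dist (𝒢.pt g x) (𝒢.pt h y) = 𝒢.pathDist (g⁻¹ * h).toWord x y := rfl

theorem dist_pt_pt (g : FreeGroup ι) (x y : K) : dist (𝒢.pt g x) (𝒢.pt g y) = dist x y :=
  𝒢.preDist_mk_mk g x y

theorem isometry_smul_tree (g : FreeGroup ι) : Isometry fun X : 𝒢.Tree => g • X := by
  refine Isometry.of_dist_eq fun X Y => ?_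
  obtain ⟨P, rfl⟩ := SeparationQuotient.surjective_mk X
  obtain ⟨Q, rfl⟩ := SeparationQuotient.surjective_mk Y
  exact dist_smul g P Q

theorem pt_eq_of_cost_eq_zero (g : FreeGroup ι) {z : ι × Bool} {x : K} (h : 𝒢.cost z x = 0) :
    𝒢.pt g x = 𝒢.pt (g * letterElt z) (𝒢.proj z x) := by
  refine dist_le_zero.1 ?_
  rw [dist_pt, inv_mul_cancel_left, letterElt, toWord_mk_of_isReduced (List.isChain_singleton z)]
  simp [pathDist, h]

theorem pt_proj (g : FreeGroup ι) (z : ι × Bool) (x : K) :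
    𝒢.pt (g * letterElt z) (𝒢.proj z x) = 𝒢.pt g (𝒢.proj (invLetter z) (𝒢.proj z x)) := by
  have h := 𝒢.pt_eq_of_cost_eq_zero (g * letterElt z) (𝒢.cost_proj z x)
  rwa [letterElt_invLetter, mul_inv_cancel_right] at h

theorem tree_induction {P : 𝒢.Tree → 𝒢.Tree → Prop} (base : ∀ g x y, P (𝒢.pt g x) (𝒢.pt g y))
    (trans : ∀ X Y Z, dist X Z = dist X Y + dist Y Z → P X Y → P Y Z → P X Z) (X Y : 𝒢.Tree) :
    P X Y := by
  have key : ∀ (l : List (ι × Bool)), FreeGroup.IsReduced l → ∀ (g : FreeGroup ι) (x y : K),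
      P (𝒢.pt g x) (𝒢.pt (g * FreeGroup.mk l) y) := by
    intro l
    induction l with
    | nil =>
      intro _ g x y
      rw [← FreeGroup.one_eq_mk, mul_one]
      exact base g x y
    | cons z l ih =>
      intro hr g x y
      have hl : FreeGroup.IsReduced l :=
        (isReduced_append_iff.1 (show FreeGroup.IsReduced ([z] ++ l) from hr)).2.1
      have hmul : g * FreeGroup.mk (z :: l) = g * letterElt z * FreeGroup.mk l := by
        rw [mk_cons, mul_assoc]
      refine trans _ (𝒢.pt (g * letterElt z) (𝒢.proj z x)) _ ?_ ?_ ?_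
      · rw [𝒢.pt_proj, dist_pt_pt, dist_proj_proj, ← 𝒢.pt_proj, dist_pt, dist_pt,
          inv_mul_cancel_left, hmul, inv_mul_cancel_left, toWord_mk_of_isReduced hr,
          toWord_mk_of_isReduced hl]
        rfl
      · rw [𝒢.pt_proj]
        exact base _ _ _
      · rw [hmul]
        exact ih hl _ _ _
  obtain ⟨g, x, rfl⟩ := 𝒢.exists_eq_pt X
  obtain ⟨h, y, rfl⟩ := 𝒢.exists_eq_pt Y
  have := key (g⁻¹ * h).toWord FreeGroup.isReduced_toWord g x y
  rwa [FreeGroup.mk_toWord, mul_inv_cancel_left] at this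

theorem tree_four_point (X Y Z W : 𝒢.Tree) :
    dist X Y + dist Z W ≤ max (dist X Z + dist Y W) (dist X W + dist Y Z) := by
  obtain ⟨P, rfl⟩ := SeparationQuotient.surjective_mk X
  obtain ⟨Q, rfl⟩ := SeparationQuotient.surjective_mk Y
  obtain ⟨R, rfl⟩ := SeparationQuotient.surjective_mk Z
  obtain ⟨S, rfl⟩ := SeparationQuotient.surjective_mk W
  exact (𝒢.fourPt_preDist P Q R S).1

theorem exists_mem_seg_tree (X Y : 𝒢.Tree) :
    ∀ t ∈ Icc 0 (dist X Y), ∃ Z ∈ seg X Y, dist X Z = t := by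
  refine 𝒢.tree_induction (P := fun X Y => ∀ t ∈ Icc 0 (dist X Y), ∃ Z ∈ seg X Y, dist X Z = t)
    ?_ ?_ X Y
  · intro g x y t ht
    rw [dist_pt_pt] at ht
    obtain ⟨z, hz, hzt⟩ := exists_mem_seg ht.1 ht.2
    refine ⟨𝒢.pt g z, ?_, ?_⟩
    · simpa only [mem_seg, dist_pt_pt] using hz
    · rwa [dist_pt_pt]
  · intro X Y Z h hXY hYZ t ht
    rcases le_total t (dist X Y) with h' | h'
    · obtain ⟨W, hW, hWt⟩ := hXY t ⟨ht.1, h'⟩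
      exact ⟨W, mem_seg_of_mem_left (mem_seg.2 h.symm) hW, hWt⟩
    · obtain ⟨W, hW, hWt⟩ := hYZ (t - dist X Y) ⟨by linarith, by linarith [ht.2]⟩
      refine ⟨W, mem_seg_of_mem_right (mem_seg.2 h.symm) hW, ?_⟩
      have := mem_seg.1 (mem_seg_of_mem_right' (mem_seg.2 h.symm) hW)
      linarith

instance : IsRTree 𝒢.Tree where
  four_point := 𝒢.tree_four_point
  geodesic X Y := by
    have : Nonempty 𝒢.Tree := ⟨X⟩
    choose! f hf hft using 𝒢.exists_mem_seg_tree X Y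
    refine ⟨f, ?_, ?_, ?_⟩
    · exact (dist_le_zero.1 (hft 0 ⟨le_rfl, dist_nonneg⟩).le).symm
    · have h := mem_seg.1 (hf _ ⟨dist_nonneg, le_rfl⟩)
      rw [hft _ ⟨dist_nonneg, le_rfl⟩] at h
      exact dist_le_zero.1 (by linarith)
    · have key : ∀ s ∈ Icc (0 : ℝ) (dist X Y), ∀ t ∈ Icc (0 : ℝ) (dist X Y), s ≤ t →
          dist (f s) (f t) = t - s := by
        intro s hs t ht hst
        have e1 := mem_seg.1 (hf s hs)
        have e2 := mem_seg.1 (hf t ht)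
        have e3 := hft s hs
        have e4 := hft t ht
        have h := 𝒢.tree_four_point X Y (f s) (f t)
        have e5 := dist_comm Y (f s)
        have e6 := dist_comm Y (f t)
        rw [le_max_iff] at h
        refine le_antisymm ?_ (by linarith [dist_triangle X (f s) (f t)])
        rcases h with h | h <;> linarith
      intro s hs t ht
      rcases le_total s t with h | h
      · rw [key s hs t ht h, abs_sub_comm, abs_of_nonneg (by linarith)]
      · rw [dist_comm, key t ht s hs h, abs_of_nonneg (by linarith)]

theorem isSubtree_range_pt (g : FreeGroup ι) : IsSubtree (range (𝒢.pt g)) := by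
  rintro _ ⟨x, rfl⟩ _ ⟨y, rfl⟩ p hp
  obtain ⟨h, w, rfl⟩ := 𝒢.exists_eq_pt p
  obtain ⟨q, hq⟩ := 𝒢.exists_preDist_eq (h, w) g
  have hq' : ∀ y, dist (𝒢.pt h w) (𝒢.pt g y) = dist (𝒢.pt h w) (𝒢.pt g q) + dist q y := hq
  have e := mem_seg.1 hp
  rw [dist_comm (𝒢.pt g x), hq' x, hq' y, dist_pt_pt] at e
  refine ⟨q, (dist_le_zero.1 ?_).symm⟩
  linarith [dist_triangle x q y, dist_comm x q]

theorem range_pt (g : FreeGroup ι) : range (𝒢.pt g) = g • range (𝒢.pt 1) := by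
  ext X
  rw [mem_smul_set]
  constructor
  · rintro ⟨x, rfl⟩
    exact ⟨_, ⟨x, rfl⟩, by rw [smul_pt, mul_one]⟩
  · rintro ⟨_, ⟨x, rfl⟩, rfl⟩
    exact ⟨x, by rw [smul_pt, mul_one]⟩

theorem exists_seg_subset (X Y : 𝒢.Tree) :
    ∃ F : Finset (FreeGroup ι), seg X Y ⊆ ⋃ w ∈ F, w • range (𝒢.pt 1) := by
  refine 𝒢.tree_induction (P := fun X Y => ∃ F : Finset (FreeGroup ι),
    seg X Y ⊆ ⋃ w ∈ F, w • range (𝒢.pt 1)) ?_ ?_ X Y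
  · intro g x y
    refine ⟨{g}, ?_⟩
    simp only [Finset.mem_singleton, iUnion_iUnion_eq_left, ← range_pt]
    exact 𝒢.isSubtree_range_pt g _ ⟨x, rfl⟩ _ ⟨y, rfl⟩
  · rintro X Y Z - ⟨F, hF⟩ ⟨F', hF'⟩
    refine ⟨F ∪ F', fun p hp => ?_⟩
    rw [Finset.set_biUnion_union]
    exact (seg_split hp Y).imp (fun h => hF h) (fun h => hF' h)

theorem isTreeMorphism_of_injOn {T' : Type*} [MetricSpace T'] {f : 𝒢.Tree → T'}
    (hf : Continuous f) (hinj : ∀ g, InjOn f (range (𝒢.pt g))) : IsTreeMorphism f := by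
  classical
  refine ⟨hf, fun X Y => ?_⟩
  refine 𝒢.tree_induction (P := fun X Y => ∃ F : Finset 𝒢.Tree,
    ∀ p ∈ seg X Y, p ∉ (F : Set 𝒢.Tree) → ∃ U ∈ nhdsWithin p (seg X Y), Set.InjOn f U) ?_ ?_ X Y
  · intro g x y
    exact ⟨∅, fun p _ _ => ⟨_, self_mem_nhdsWithin,
      (hinj g).mono (𝒢.isSubtree_range_pt g _ ⟨x, rfl⟩ _ ⟨y, rfl⟩)⟩⟩
  · have key : ∀ {A B C U : Set 𝒢.Tree} {p : 𝒢.Tree}, A ⊆ B ∪ C → IsClosed C → p ∉ C →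
        U ∈ 𝓝[B] p → U ∈ 𝓝[A] p := by
      intro A B C U p hA hC hp hU
      rw [mem_nhdsWithin] at *
      obtain ⟨V, hV, hpV, hVU⟩ := hU
      refine ⟨V ∩ Cᶜ, hV.inter hC.isOpen_compl, ⟨hpV, hp⟩, ?_⟩
      rintro q ⟨⟨hqV, hqC⟩, hqA⟩
      exact hVU ⟨hqV, (hA hqA).resolve_right hqC⟩
    rintro X Y Z h ⟨F, hF⟩ ⟨F', hF'⟩
    have hmeet : ∀ p, p ∈ seg X Y → p ∈ seg Y Z → p = Y := by
      intro p h1 h2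
      rw [mem_seg] at h1 h2
      refine dist_le_zero.1 ?_
      linarith [dist_triangle X p Z, dist_comm Y p]
    refine ⟨insert Y (F ∪ F'), fun p hp hpF => ?_⟩
    simp only [Finset.coe_insert, Finset.coe_union, mem_insert_iff, mem_union, not_or] at hpF
    obtain ⟨hpY, hpF, hpF'⟩ := hpF
    rcases seg_split hp Y with h' | h'
    · obtain ⟨U, hU, hi⟩ := hF p h' hpF
      exact ⟨U, key (fun q hq => seg_split hq Y) (isClosed_seg Y Z)
        (fun h'' => hpY (hmeet p h' h'')) hU, hi⟩
    · obtain ⟨U, hU, hi⟩ := hF' p h' hpF'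
      exact ⟨U, key (fun q hq => (seg_split hq Y).symm) (isClosed_seg X Y)
        (fun h'' => hpY (hmeet p h'' h')) hU, hi⟩

section Universal

variable {T' : Type*} [MetricSpace T'] [MulAction (FreeGroup ι) T']

theorem exists_universal (hiso : ∀ g : FreeGroup ι, Isometry fun x : T' => g • x)
    {e' : K → T'} (he : Isometry e')
    (hc : ∀ z x, 𝒢.cost z x = 0 → (letterElt z)⁻¹ • e' x = e' (𝒢.proj z x)) :
    ∃ f : 𝒢.Tree → T', IsTreeMorphism f ∧ (∀ g x, f (𝒢.pt g x) = g • e' x) ∧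
      ∀ X Y, dist (f X) (f Y) ≤ dist X Y := by
  have hle : ∀ P Q : 𝒢.Pt, dist (P.1 • e' P.2) (Q.1 • e' Q.2) ≤ dist P Q := by
    intro P Q
    have h := 𝒢.dist_smul_le_pathDist hiso he hc (P.1⁻¹ * Q.1).toWord P.2 Q.2
    rw [FreeGroup.mk_toWord, ← (hiso P.1).dist_eq] at h
    simp only [smul_smul, mul_inv_cancel_left] at h
    exact h
  let f : 𝒢.Tree → T' := SeparationQuotient.lift (fun P : 𝒢.Pt => P.1 • e' P.2) fun P Q hPQ =>
    dist_le_zero.1 ((hle P Q).trans (Metric.inseparable_iff.1 hPQ).le)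
  have hfpt : ∀ g x, f (𝒢.pt g x) = g • e' x := fun g x => rfl
  have hf1 : ∀ X Y, dist (f X) (f Y) ≤ dist X Y := by
    intro X Y
    obtain ⟨P, rfl⟩ := SeparationQuotient.surjective_mk X
    obtain ⟨Q, rfl⟩ := SeparationQuotient.surjective_mk Y
    exact hle P Q
  have hcont : Continuous f :=
    (LipschitzWith.of_dist_le_mul (K := 1) (by simpa using hf1)).continuous
  refine ⟨f, 𝒢.isTreeMorphism_of_injOn hcont ?_, hfpt, hf1⟩
  rintro g _ ⟨x, rfl⟩ _ ⟨y, rfl⟩ hxy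
  rw [hfpt, hfpt] at hxy
  rw [he.injective ((hiso g).injective hxy)]

end Universal

end Gluing

end CHL

namespace CHL

section Induced

variable {ι : Type*} {T : Type*} [MulAction (FreeGroup ι) T]

theorem letterElt_smul_inter_nonempty {K : Set T}
    (hmeet : ∀ i : ι, (K ∩ FreeGroup.of i • K).Nonempty) (z : ι × Bool) :
    (K ∩ letterElt z • K).Nonempty := by
  obtain ⟨i, _ | _⟩ := z
  · obtain ⟨_, hx, y, hy, rfl⟩ := hmeet i
    exact ⟨y, hy, FreeGroup.of i • y, hx, inv_smul_smul (FreeGroup.of i) y⟩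
  · exact hmeet i

variable [MetricSpace T] [IsRTree T]

/-- The gluing data of the partial isometries induced on a compact subtree `K` by the letters. -/
theorem exists_induced_gluing (hiso : ∀ g : FreeGroup ι, Isometry fun x : T => g • x) {K : Set T}
    (hK : IsCompact K) (hs : IsSubtree K) (hmeet : ∀ i : ι, (K ∩ FreeGroup.of i • K).Nonempty) :
    ∃ 𝒢 : Gluing ι K, ∀ (z : ι × Bool) (x : K),
      (𝒢.cost z x = 0 ↔ (letterElt z)⁻¹ • (x : T) ∈ K) ∧
      (𝒢.cost z x = 0 → (𝒢.proj z x : T) = (letterElt z)⁻¹ • (x : T)) := by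
  have hd : ∀ (g : FreeGroup ι) (a b : T), dist (g • a) (g • b) = dist a b :=
    fun g a b => (hiso g).dist_eq a b
  have hgate : ∀ (z : ι × Bool) (x : T), ∃ q ∈ K ∩ letterElt z • K, ∀ a ∈ K ∩ letterElt z • K,
      q ∈ seg x a := by
    intro z x
    have h1 : IsClosed (letterElt z • K) := (hK.image (hiso (letterElt z)).continuous).isClosed
    have h2 : IsSubtree (letterElt z • K) := hs.smul hiso (letterElt z)
    exact exists_gate (hK.inter_right h1) (letterElt_smul_inter_nonempty hmeet z) (hs.inter h2) x
  choose π hπ hseg using hgate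
  have hswap : ∀ (z : ι × Bool) (a : T), a ∈ K ∩ letterElt z • K →
      (letterElt z)⁻¹ • a ∈ K ∩ letterElt (invLetter z) • K := by
    rintro z _ ⟨ha, b, hb, rfl⟩
    have hb' : (letterElt z)⁻¹ • (fun x : T => letterElt z • x) b = b := inv_smul_smul _ b
    rw [hb']
    exact ⟨hb, letterElt z • b, ha, by rw [letterElt_invLetter]; exact inv_smul_smul _ b⟩
  have hswap' : ∀ (z : ι × Bool) (a : T), a ∈ K ∩ letterElt (invLetter z) • K →
      letterElt z • a ∈ K ∩ letterElt z • K := by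
    intro z a ha
    have := hswap _ a ha
    rwa [invLetter_invLetter, letterElt_invLetter, inv_inv] at this
  have hself : ∀ (z : ι × Bool) (a : T), a ∈ K ∩ letterElt z • K → π z a = a := fun z a ha =>
    eq_of_mem_seg_self (hseg z a a ha)
  refine ⟨⟨fun z x => ⟨(letterElt z)⁻¹ • π z x, (hswap z _ (hπ z x)).1⟩,
    fun z x => dist (x : T) (π z x), ?_, ?_, ?_, ?_⟩, ?_⟩
  · intro z x y
    change dist (x : T) (π z x) + dist ((letterElt z)⁻¹ • π z x) (y : T) =
      dist (x : T) ((letterElt (invLetter z))⁻¹ • π (invLetter z) y) +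
        dist (y : T) (π (invLetter z) y)
    have h1 := mem_seg.1 (hseg _ (y : T) _ (hswap z _ (hπ z x)))
    have h2 := mem_seg.1 (hseg _ (x : T) _ (hswap' z _ (hπ (invLetter z) y)))
    have h3 := hd (letterElt z) ((letterElt z)⁻¹ • π z x) (π (invLetter z) y)
    rw [smul_inv_smul] at h3
    rw [letterElt_invLetter, inv_inv, dist_comm _ (y : T), ← h1, ← h2, h3,
      dist_comm (π (invLetter z) y)]
    ring
  · intro z x y
    by_cases h : π z x = π z y
    · left
      simp only [h]
    · right
      change dist (x : T) y = dist (x : T) (π z x) + dist (y : T) (π z y) +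
        dist ((letterElt z)⁻¹ • π z x) ((letterElt z)⁻¹ • π z y)
      rw [hd]
      have h1 := mem_seg.1 (hseg _ (x : T) _ (hπ z y))
      have h2 := mem_seg.1 (hseg _ (y : T) _ (hπ z x))
      have h3 := dist_comm (π z x) (π z y)
      have h4 := dist_comm (y : T) (π z y)
      have h5 := dist_pos.2 h
      rcases four_point_le (x : T) (π z y) y (π z x) with h6 | h6
      · linarith [dist_triangle (x : T) (π z x) y, dist_triangle (π z x) (π z y) y,
          dist_comm (π z y) y, dist_comm (y : T) (π z x)]
      · linarith
  · intro z x y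
    change dist (x : T) y ≤ dist (x : T) (π z x) + dist (y : T) (π z y) +
        dist ((letterElt z)⁻¹ • π z x) ((letterElt z)⁻¹ • π z y)
    rw [hd]
    linarith [dist_triangle4 (x : T) (π z x) (π z y) y, dist_comm (y : T) (π z y)]
  · intro z x
    change dist ((letterElt z)⁻¹ • π z x) (π (invLetter z) ((letterElt z)⁻¹ • π z x)) = 0
    rw [hself _ _ (hswap z _ (hπ z x)), dist_self]
  · intro z x
    change (dist (x : T) (π z x) = 0 ↔ _) ∧ (dist (x : T) (π z x) = 0 → (letterElt z)⁻¹ • π z x = _)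
    rw [dist_eq_zero]
    refine ⟨⟨fun h => h ▸ (hswap z _ (hπ z x)).1, fun h => (hself z x ⟨x.2, ?_⟩).symm⟩,
      fun h => by rw [← h]⟩
    exact ⟨_, h, smul_inv_smul _ _⟩

end Induced

/-- The tree associated to a compact subtree, together with its canonical `1`-Lipschitz map. -/
theorem exists_inducedAssoc {ι : Type} [DecidableEq ι] (St : TreeSetup ι) {K : Set St.Tb}
    (hK : IsCompact K) (hs : IsSubtree K)
    (hmeet : ∀ i : ι, (K ∩ FreeGroup.of i • K).Nonempty) :
    ∃ IA : InducedAssoc St K, ∀ X Y : IA.TK, dist (IA.jmap X) (IA.jmap Y) ≤ dist X Y := by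
  have := St.tree
  have := hs.isRTree
  obtain ⟨𝒢, h𝒢⟩ := exists_induced_gluing St.act_isom hK hs hmeet
  have hcompat : ∀ {T' : Type} [MetricSpace T'] [MulAction (FreeGroup ι) T'] {e' : K → T'},
      InducedCompat St K e' →
      ∀ z x, 𝒢.cost z x = 0 → (letterElt z)⁻¹ • e' x = e' (𝒢.proj z x) := by
    intro T' _ _ e' he z x hx
    have hmem := (h𝒢 z x).1.1 hx
    have hproj : 𝒢.proj z x = ⟨(letterElt z)⁻¹ • (x : St.Tb), hmem⟩ :=
      Subtype.ext ((h𝒢 z x).2 hx)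
    rw [hproj]
    obtain ⟨i, _ | _⟩ := z
    · have hmem' : (FreeGroup.of i)⁻¹ • (letterElt (i, false))⁻¹ • (x : St.Tb) ∈ K := by
        rw [show (letterElt (i, false))⁻¹ = FreeGroup.of i from rfl, inv_smul_smul]
        exact x.2
      have h := he i ⟨_, hmem⟩ hmem'
      rw [inv_smul_eq_iff] at h
      rw [h]
      congr 2
      exact Subtype.ext (inv_smul_smul (FreeGroup.of i) (x : St.Tb)).symm
    · exact he i x hmem
  have hval : InducedCompat St K (Subtype.val : K → St.Tb) := fun i x h => rfl
  obtain ⟨j, hj, hjpt, hj1⟩ := 𝒢.exists_universal St.act_isom isometry_subtype_coe (hcompat hval)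
  have hequiv : ∀ {T' : Type} [MulAction (FreeGroup ι) T'] {e' : K → T'} {f : 𝒢.Tree → T'},
      (∀ g x, f (𝒢.pt g x) = g • e' x) →
      (∀ (g : FreeGroup ι) (p : 𝒢.Tree), f (g • p) = g • f p) ∧ ∀ x, f (𝒢.pt 1 x) = e' x := by
    intro T' _ e' f hf
    refine ⟨fun g p => ?_, fun x => by rw [hf, one_smul]⟩
    obtain ⟨h, x, rfl⟩ := 𝒢.exists_eq_pt p
    rw [𝒢.smul_pt, hf, hf, mul_smul]
  refine ⟨{
    TK := 𝒢.Tree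
    tree := inferInstance
    act_isom := 𝒢.isometry_smul_tree
    emb := 𝒢.pt 1
    emb_isom := Isometry.of_dist_eq (𝒢.dist_pt_pt 1)
    emb_subtree := 𝒢.isSubtree_range_pt 1
    compat := ?_
    orbit_meets := ?_
    seg_cover := 𝒢.exists_seg_subset
    universal := ?_
    jmap := j
    jmap_morphism := hj
    jmap_equivariant := (hequiv hjpt).1
    jmap_emb := (hequiv hjpt).2 }, hj1⟩
  · intro i x h
    have h0 : 𝒢.cost (i, true) x = 0 := (h𝒢 (i, true) x).1.2 h
    rw [inv_smul_eq_iff, 𝒢.smul_pt, 𝒢.pt_eq_of_cost_eq_zero 1 h0, mul_one, one_mul]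
    congr 1
    exact Subtype.ext ((h𝒢 (i, true) x).2 h0)
  · intro p
    obtain ⟨g, x, rfl⟩ := 𝒢.exists_eq_pt p
    exact ⟨g, x, by rw [𝒢.smul_pt, mul_one]⟩
  · intro T' _ _ hiso e' he hc
    obtain ⟨f, hf, hfpt, -⟩ := 𝒢.exists_universal hiso he (hcompat hc)
    refine ⟨f, ⟨hf, (hequiv hfpt).1, (hequiv hfpt).2⟩, ?_⟩
    rintro f' ⟨-, h1, h2⟩
    funext p
    obtain ⟨g, x, rfl⟩ := 𝒢.exists_eq_pt p
    rw [hfpt, ← mul_one g, ← 𝒢.smul_pt, h1, h2, mul_one]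

end CHL

namespace CHL

/-- Edges `e m` joining `eR m` to `eL m` are fewer than vertices, as soon as every edge is separated
from the smaller ones by a set of vertices. -/
theorem card_le_card_of_separating {M V : Type*} [Fintype M] [LinearOrder M] [Fintype V]
    [DecidableEq V] (eR eL : M → V)
    (h : ∀ m, ∃ S : V → Prop, S (eR m) ∧ ¬ S (eL m) ∧ ∀ m' < m, (S (eR m') ↔ S (eL m'))) :
    Fintype.card M ≤ Fintype.card V := by
  classical
  have hli : LinearIndependent ℚ fun m => (Pi.single (eR m) 1 - Pi.single (eL m) 1 : V → ℚ) := by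
    rw [Fintype.linearIndependent_iff]
    intro a ha
    by_contra! hne
    obtain ⟨m₁, hm₁⟩ := hne
    obtain ⟨m, hm, hmax⟩ := (Finset.univ.filter fun m => a m ≠ 0).exists_max_image id
      ⟨m₁, by simpa using hm₁⟩
    obtain ⟨S, hSR, hSL, hS⟩ := h m
    have h1 := congrArg (fun f : V → ℚ => ∑ v, (if S v then 1 else 0) * f v) ha
    simp only [Finset.sum_apply, Finset.mul_sum, Pi.smul_apply, Pi.sub_apply, smul_eq_mul,
      Pi.zero_apply, mul_zero, Finset.sum_const_zero] at h1
    rw [Finset.sum_comm] at h1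
    have h2 : ∀ m', ∑ v, (if S v then (1 : ℚ) else 0) *
        (a m' * ((Pi.single (eR m') 1 : V → ℚ) v - (Pi.single (eL m') 1 : V → ℚ) v)) =
        a m' * ((if S (eR m') then 1 else 0) - if S (eL m') then 1 else 0) := by
      intro m'
      simp only [Pi.single_apply, mul_sub, Finset.sum_sub_distrib]
      simp
    simp only [h2] at h1
    rw [Finset.sum_eq_single m] at h1
    · simp [hSR, hSL] at h1
      simp [h1] at hm
    · intro m' _ hm'
      by_cases ha' : a m' = 0
      · simp [ha']
      · have : m' < m := lt_of_le_of_ne (hmax m' (by simpa using ha')) hm'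
        simp [hS m' this]
    · simp
  simpa using hli.fintype_card_le_finrank

/-- The sums of at most `n` copies of each element of `D`. -/
def boundedSums (D : Finset ℝ) (n : ℕ) : Finset ℝ :=
  (Fintype.piFinset fun _ : D => Finset.range (n + 1)).image fun f => ∑ d : D, f d • (d : ℝ)

theorem card_boundedSums_le (D : Finset ℝ) (n : ℕ) : (boundedSums D n).card ≤ (n + 1) ^ D.card :=
  Finset.card_image_le.trans (by simp)

theorem card_boundedSums_pos (D : Finset ℝ) (n : ℕ) : 0 < (boundedSums D n).card :=
  Finset.card_pos.2 (Finset.Nonempty.image ⟨0, by simp⟩ _)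

theorem add_mem_boundedSums {D : Finset ℝ} {n : ℕ} {c d : ℝ} (hc : c ∈ boundedSums D n)
    (hd : d ∈ D) : c + d ∈ boundedSums D (n + 1) := by
  obtain ⟨f, hf, rfl⟩ := Finset.mem_image.1 hc
  refine Finset.mem_image.2 ⟨f + Pi.single ⟨d, hd⟩ 1, ?_, ?_⟩
  · rw [Fintype.mem_piFinset] at hf ⊢
    intro a
    have h1 := Finset.mem_range.1 (hf a)
    have h2 : (Pi.single (⟨d, hd⟩ : D) 1 : D → ℕ) a ≤ 1 := by
      rw [Pi.single_apply]; split_ifs <;> simp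
    rw [Finset.mem_range, Pi.add_apply]
    omega
  · simp [add_smul, Finset.sum_add_distrib, Pi.single_apply, ite_smul]

theorem le_of_forall_card_boundedSums {D : Finset ℝ} {ℓ L : ℝ} (hL : 0 ≤ L)
    (h : ∀ n, (boundedSums D n).card * ℓ ≤ (boundedSums D (n + 1)).card * L) : ℓ ≤ L := by
  rcases hL.eq_or_lt with rfl | hL
  · have h0 := h 0
    have h1 := card_boundedSums_pos D 0
    rw [mul_zero] at h0
    exact nonpos_of_mul_nonpos_right h0 (by exact_mod_cast h1)
  by_contra! hlt
  have hgrow : ∀ n : ℕ, (ℓ / L) ^ n ≤ (boundedSums D n).card := by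
    intro n
    induction n with
    | zero => simpa using card_boundedSums_pos D 0
    | succ n ih =>
      have h1 : (ℓ / L) ^ (n + 1) ≤ (boundedSums D n).card * (ℓ / L) := by
        rw [pow_succ]
        exact mul_le_mul_of_nonneg_right ih (div_nonneg (hL.le.trans hlt.le) hL.le)
      refine h1.trans ?_
      rw [← mul_div_assoc, div_le_iff₀ hL]
      exact h n
  have h1 : 1 < ℓ / L := (one_lt_div hL).2 hlt
  have h2 := (tendsto_pow_const_div_const_pow_of_one_lt D.card h1).comp (tendsto_add_atTop_nat 1)
  have h3 : ∀ᶠ n : ℕ in atTop, ((n + 1 : ℕ) : ℝ) ^ D.card / (ℓ / L) ^ (n + 1) < (ℓ / L)⁻¹ :=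
    h2.eventually (gt_mem_nhds (by positivity))
  obtain ⟨n, hn⟩ := h3.exists
  have h4 : ((boundedSums D n).card : ℝ) ≤ ((n + 1 : ℕ) : ℝ) ^ D.card := by
    exact_mod_cast card_boundedSums_le D n
  have h5 : 0 < (ℓ / L) ^ n := by positivity
  rw [div_lt_iff₀ (by positivity), pow_succ, mul_comm ((ℓ / L) ^ n), inv_mul_cancel_left₀
    (by positivity)] at hn
  linarith [hgrow n]

theorem natCast_card_filter_add_mem (C : Finset ℝ) (I : Set ℝ) (τ : ℝ)
    [DecidablePred fun c => τ + c ∈ I] :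
    ((C.filter fun c => τ + c ∈ I).card : ENNReal) =
      ∑ c ∈ C, ((fun τ : ℝ => τ + c) ⁻¹' I).indicator 1 τ := by
  rw [Finset.card_filter]
  push_cast
  refine Finset.sum_congr rfl fun c _ => ?_
  by_cases h : τ + c ∈ I <;> simp [h]

theorem measurable_card_filter_add_mem (C : Finset ℝ) {I : Set ℝ}
    [∀ τ : ℝ, DecidablePred fun c => τ + c ∈ I] (hI : MeasurableSet I) :
    Measurable fun τ : ℝ => ((C.filter fun c => τ + c ∈ I).card : ENNReal) := by
  simp only [natCast_card_filter_add_mem]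
  exact Finset.measurable_sum _ fun c _ => measurable_one.indicator (measurable_id.add_const c hI)

open MeasureTheory in
theorem lintegral_card_filter_add_mem (C : Finset ℝ) {I : Set ℝ}
    [∀ τ : ℝ, DecidablePred fun c => τ + c ∈ I] (hI : MeasurableSet I) :
    ∫⁻ τ : ℝ, ((C.filter fun c => τ + c ∈ I).card : ENNReal) = C.card * volume I := by
  simp only [natCast_card_filter_add_mem]
  rw [lintegral_finsetSum _ fun c _ => measurable_one.indicator (measurable_add_const c hI),
    Finset.sum_congr rfl fun c _ => show _ = volume I from ?_]
  · simp
  · rw [lintegral_indicator_one (measurable_add_const c hI), measure_preimage_add_right]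

open MeasureTheory in
/-- A partial translation scheme: every point `t` of `[0, ℓ)` outside a countable set is matched
to two points of intervals `[0, L z]` by finitely many translations. If the resulting graph is
acyclic, in the sense that each link is separated from the lower ones, then `ℓ ≤ ∑ z, L z`. -/
theorem le_sum_of_separating {Z : Type*} [Fintype Z] [DecidableEq Z] {L : Z → ℝ}
    (hL : ∀ z, 0 ≤ L z) {ℓ : ℝ} {D : Finset ℝ} {B : Set ℝ} (hB : B.Countable) (eR eL : ℝ → Z × ℝ)
    (hR : ∀ t ∈ Ico 0 ℓ, (eR t).2 - t ∈ D ∧ (eR t).2 ∈ Icc 0 (L (eR t).1))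
    (hL' : ∀ t ∈ Ico 0 ℓ, (eL t).2 - t ∈ D ∧ (eL t).2 ∈ Icc 0 (L (eL t).1))
    (hS : ∀ t ∈ Ico 0 ℓ, t ∉ B → ∃ S : Z × ℝ → Prop, S (eR t) ∧ ¬ S (eL t) ∧
      ∀ t' ∈ Ico 0 t, (S (eR t') ↔ S (eL t'))) :
    ℓ ≤ ∑ z, L z := by
  classical
  rcases le_or_gt ℓ 0 with hℓ | hℓ
  · exact hℓ.trans (Finset.sum_nonneg fun z _ => hL z)
  refine le_of_forall_card_boundedSums (D := D) (Finset.sum_nonneg fun z _ => hL z) fun n => ?_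
  have hcount : ∀ᵐ τ : ℝ, ((boundedSums D n).filter fun c => τ + c ∈ Ico 0 ℓ).card ≤
      ∑ z, ((boundedSums D (n + 1)).filter fun c => τ + c ∈ Icc 0 (L z)).card := by
    have hbad : (⋃ c ∈ boundedSums D n, (fun τ : ℝ => τ + c) ⁻¹' B).Countable :=
      (Finset.countable_toSet _).biUnion fun c _ =>
        hB.preimage (add_left_injective c)
    filter_upwards [hbad.ae_notMem volume] with τ hτ
    have hτ' : ∀ c ∈ boundedSums D n, τ + c ∉ B := by simpa using hτ
    rw [← Finset.card_sigma]
    have hmemR : ∀ c ∈ (boundedSums D n).filter fun c => τ + c ∈ Ico 0 ℓ, ∀ e : Z × ℝ,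
        e.2 - (τ + c) ∈ D ∧ e.2 ∈ Icc 0 (L e.1) →
        (⟨e.1, e.2 - τ⟩ : (_ : Z) × ℝ) ∈ Finset.univ.sigma fun z =>
          (boundedSums D (n + 1)).filter fun c => τ + c ∈ Icc 0 (L z) := by
      intro c hc e he
      have h1 := add_mem_boundedSums (Finset.mem_filter.1 hc).1 he.1
      rw [show c + (e.2 - (τ + c)) = e.2 - τ by ring] at h1
      simp only [Finset.mem_sigma, Finset.mem_univ, true_and, Finset.mem_filter]
      exact ⟨h1, by rw [add_sub_cancel]; exact he.2⟩
    have key := card_le_card_of_separating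
      (M := ((boundedSums D n).filter fun c => τ + c ∈ Ico 0 ℓ : Finset ℝ))
      (V := Finset.univ.sigma fun z =>
          (boundedSums D (n + 1)).filter fun c => τ + c ∈ Icc 0 (L z))
      (fun c => ⟨_, hmemR c c.2 _ (hR _ (Finset.mem_filter.1 c.2).2)⟩)
      (fun c => ⟨_, hmemR c c.2 _ (hL' _ (Finset.mem_filter.1 c.2).2)⟩) ?_
    · simpa only [Fintype.card_coe] using key
    rintro ⟨c, hc⟩
    obtain ⟨hc1, hc2⟩ := Finset.mem_filter.1 hc
    obtain ⟨S, h1, h2, h3⟩ := hS _ hc2 (hτ' c hc1)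
    refine ⟨fun v => S (v.1.1, τ + v.1.2), by simpa using h1, by simpa using h2, ?_⟩
    rintro ⟨c', hc'⟩ hlt
    have := h3 (τ + c') ⟨(Finset.mem_filter.1 hc').2.1, by
      have : c' < c := hlt
      linarith⟩
    simpa using this
  have hle := lintegral_mono_ae (μ := volume) (hcount.mono fun τ h =>
    show ((((boundedSums D n).filter fun c => τ + c ∈ Ico 0 ℓ).card : ℕ) : ENNReal) ≤
      ((∑ z, ((boundedSums D (n + 1)).filter fun c => τ + c ∈ Icc 0 (L z)).card : ℕ) : ENNReal) by
    exact_mod_cast h)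
  push_cast at hle
  rw [lintegral_card_filter_add_mem _ measurableSet_Ico, lintegral_finsetSum] at hle
  · simp only [lintegral_card_filter_add_mem _ measurableSet_Icc] at hle
    rw [← Finset.mul_sum] at hle
    simp only [Real.volume_Ico, Real.volume_Icc, sub_zero] at hle
    rw [← ENNReal.ofReal_sum_of_nonneg fun z _ => hL z, ← ENNReal.ofReal_natCast,
      ← ENNReal.ofReal_natCast, ← ENNReal.ofReal_mul (by positivity),
      ← ENNReal.ofReal_mul (by positivity)] at hle
    exact (ENNReal.ofReal_le_ofReal_iff
      (mul_nonneg (by positivity) (Finset.sum_nonneg fun z _ => hL z))).1 hle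
  · exact fun z _ => measurable_card_filter_add_mem _ measurableSet_Icc

end CHL

namespace CHL

section Walks

variable {ι : Type*}

/-- The `k`-th point on the path read from `p` along the word `l`. -/
def walk {T : Type*} [MulAction (FreeGroup ι) T] (p : T) (l : List (ι × Bool)) (k : ℕ) : T :=
  FreeGroup.mk (l.take k) • p

/-- The total displacement of `p` under the letters. -/
def totalDisplacement (ι : Type*) [Fintype ι] {T : Type*} [MetricSpace T]
    [MulAction (FreeGroup ι) T] (p : T) : ℝ :=
  ∑ z : ι × Bool, dist p (letterElt z • p)

theorem mk_take_succ {l : List (ι × Bool)} {k : ℕ} (hk : k < l.length) :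
    FreeGroup.mk (l.take (k + 1)) = FreeGroup.mk (l.take k) * letterElt l[k] := by
  rw [List.take_succ_eq_append_getElem hk, mk_append_singleton]

@[simp] theorem mk_take_zero (l : List (ι × Bool)) : FreeGroup.mk (l.take 0) = 1 := rfl

section

variable {T : Type*} [MulAction (FreeGroup ι) T]

@[simp] theorem walk_zero (p : T) (l : List (ι × Bool)) : walk p l 0 = p := one_smul _ p

theorem walk_length (p : T) (l : List (ι × Bool)) : walk p l l.length = FreeGroup.mk l • p := by
  rw [walk, List.take_length]

theorem walk_succ (p : T) {l : List (ι × Bool)} {k : ℕ} (hk : k < l.length) :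
    walk p l (k + 1) = FreeGroup.mk (l.take k) • letterElt l[k] • p := by
  rw [walk, mk_take_succ hk, mul_smul]

end

section

variable {T : Type*} [MetricSpace T] [IsRTree T]

theorem exists_crossing {q : ℕ → T} {N : ℕ} {x m : T} (h0 : x ∈ seg (q 0) m)
    (hN : x ∉ seg (q N) m) :
    ∃ k < N, (∀ j ≤ k, x ∈ seg (q j) m) ∧ x ∈ seg (q k) (q (k + 1)) := by
  classical
  have hex : ∃ k, x ∉ seg (q k) m := ⟨N, hN⟩
  obtain ⟨k, hk⟩ : ∃ k, Nat.find hex = k + 1 :=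
    Nat.exists_eq_succ_of_ne_zero fun h => Nat.find_spec hex (h ▸ h0)
  have hlt : ∀ j ≤ k, x ∈ seg (q j) m := fun j hj =>
    not_not.1 (Nat.find_min hex (by omega))
  refine ⟨k, by have := Nat.find_min' hex hN; omega, hlt, ?_⟩
  exact (seg_split (hlt k le_rfl) _).resolve_right (hk ▸ Nat.find_spec hex)

theorem exists_end [MulAction (FreeGroup ι) T]
    (hiso : ∀ g : FreeGroup ι, Isometry fun x : T => g • x) {p m x : T}
    {l : List (ι × Bool)} (hm : m ∈ seg p (FreeGroup.mk l • p)) (hx : x ∈ seg p m)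
    (hlt : dist p x < dist p m) :
    ∃ k : Fin l.length, (FreeGroup.mk (l.take k))⁻¹ • x ∈ seg p (letterElt l[k] • p) ∧
      ∀ j ≤ (k : ℕ), x ∈ seg (walk p l j) m := by
  obtain ⟨k, hk, hj, hseg⟩ := exists_crossing (q := walk p l) (N := l.length) (x := x) (m := m)
    (by rwa [walk_zero]) (fun h => by
      rw [walk_length] at h
      have h1 := mem_seg.1 hm
      have h2 := mem_seg.1 hx
      have h3 := mem_seg.1 h
      have h4 := dist_triangle p x (FreeGroup.mk l • p)
      linarith [dist_comm m (FreeGroup.mk l • p), dist_comm x (FreeGroup.mk l • p)])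
  refine ⟨⟨k, hk⟩, ?_, hj⟩
  change (FreeGroup.mk (l.take k))⁻¹ • x ∈ seg p (letterElt l[k] • p)
  rw [← seg_smul hiso (FreeGroup.mk (l.take k)), smul_inv_smul, ← walk_succ p hk]
  exact hseg

end

variable [DecidableEq ι]

/-- The direction at the vertex `1` of the Cayley tree in which the edge from `g` labelled `z`
points away, or lies. -/
def edgeDirection (g : FreeGroup ι) (z : ι × Bool) : Option (ι × Bool) :=
  if g = 1 then some z else g.toWord.head?

theorem edgeDirection_mk_take {l : List (ι × Bool)} (hl : FreeGroup.IsReduced l) {k : ℕ}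
    (hk : k < l.length) : edgeDirection (FreeGroup.mk (l.take k)) l[k] = l.head? := by
  have hw : (FreeGroup.mk (l.take k)).toWord = l.take k :=
    toWord_mk_of_isReduced (hl.infix (l.take_prefix k).isInfix)
  by_cases h : l.take k = []
  · rw [edgeDirection, if_pos (by rw [h]; rfl)]
    rcases List.take_eq_nil_iff.1 h with rfl | rfl
    · rw [List.head?_eq_getElem?, List.getElem?_eq_getElem hk]
    · simp at hk
  · rw [edgeDirection, if_neg (by rwa [← FreeGroup.toWord_eq_nil_iff, hw]), hw, List.head?_take,
      if_neg]
    rintro rfl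
    simp at h

theorem edgeDirection_mul_mk_take {h : FreeGroup ι} {l : List (ι × Bool)} {k : ℕ}
    (hk : k ≤ l.length) (hne : ∀ j ≤ k, h * FreeGroup.mk (l.take j) ≠ 1) (z : ι × Bool) :
    edgeDirection (h * FreeGroup.mk (l.take k)) z = h.toWord.head? := by
  rw [edgeDirection, if_neg (hne k le_rfl)]
  induction k with
  | zero => rw [mk_take_zero, mul_one]
  | succ k ih =>
    have h1 := hne (k + 1) le_rfl
    rw [mk_take_succ hk, ← mul_assoc] at h1 ⊢
    rw [head?_toWord_mul_letterElt (hne k (Nat.le_succ k)) h1]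
    exact ih (Nat.le_of_succ_le hk) fun j hj => hne j (Nat.le_succ_of_le hj)

variable {T : Type*} [MetricSpace T] [MulAction (FreeGroup ι) T]

/-- The pairs of a letter `z` and a position `r` on `[p, z p]` a translate of which passes through
`y` in the direction `d`. -/
def passingSet (p y : T) (d : Option (ι × Bool)) : Set ((ι × Bool) × ℝ) :=
  {e | ∃ (g : FreeGroup ι) (c : T), c ∈ seg p (letterElt e.1 • p) ∧ dist p c = e.2 ∧ g • c = y ∧
    edgeDirection g e.1 = d}

variable [IsRTree T]

theorem mem_passingSet_iff (hiso : ∀ g : FreeGroup ι, Isometry fun x : T => g • x) {p x y : T}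
    {l : List (ι × Bool)} {k : ℕ} (hk : k < l.length)
    (hx : (FreeGroup.mk (l.take k))⁻¹ • x ∈ seg p (letterElt l[k] • p))
    (hlt : ∀ j ≤ k, dist (walk p l j) x < dist p y) (d : Option (ι × Bool)) :
    (l[k], dist (walk p l k) x) ∈ passingSet p y d ↔
      ∃ h : FreeGroup ι, h • x = y ∧ h.toWord.head? = d := by
  have hdist : dist p ((FreeGroup.mk (l.take k))⁻¹ • x) = dist (walk p l k) x := by
    rw [← (hiso (FreeGroup.mk (l.take k))).dist_eq, smul_inv_smul, walk]
  have hne : ∀ h : FreeGroup ι, h • x = y → ∀ j ≤ k, h * FreeGroup.mk (l.take j) ≠ 1 := by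
    intro h hh j hj h1
    have h2 := hlt j hj
    rw [← (hiso h).dist_eq, hh, walk, smul_smul, h1, one_smul] at h2
    exact h2.false
  constructor
  · rintro ⟨g, c, hc, hcr, hgc, hdir⟩
    have hcx : c = (FreeGroup.mk (l.take k))⁻¹ • x := eq_of_mem_seg hc hx (hcr.trans hdist.symm)
    have hg : (g * (FreeGroup.mk (l.take k))⁻¹) • x = y := by rw [mul_smul, ← hcx, hgc]
    refine ⟨_, hg, ?_⟩
    rw [← edgeDirection_mul_mk_take hk.le (hne _ hg) l[k], inv_mul_cancel_right]
    exact hdir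
  · rintro ⟨h, hh, hd⟩
    refine ⟨h * FreeGroup.mk (l.take k), _, hx, hdist, ?_, ?_⟩
    · rw [mul_smul, smul_inv_smul, hh]
    · rw [edgeDirection_mul_mk_take hk.le (hne _ hh), hd]

theorem mem_passingSet_iff_of_free (hiso : ∀ g : FreeGroup ι, Isometry fun x : T => g • x)
    {p y : T} {l : List (ι × Bool)} (hl : FreeGroup.IsReduced l) {k : ℕ} (hk : k < l.length)
    (hy : (FreeGroup.mk (l.take k))⁻¹ • y ∈ seg p (letterElt l[k] • p))
    (hfree : ∀ g : FreeGroup ι, g • y = y → g = 1) (d : Option (ι × Bool)) :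
    (l[k], dist (walk p l k) y) ∈ passingSet p y d ↔ l.head? = d := by
  have hdist : dist p ((FreeGroup.mk (l.take k))⁻¹ • y) = dist (walk p l k) y := by
    rw [← (hiso (FreeGroup.mk (l.take k))).dist_eq, smul_inv_smul, walk]
  constructor
  · rintro ⟨g, c, hc, hcr, hgc, hdir⟩
    have hcy : c = (FreeGroup.mk (l.take k))⁻¹ • y := eq_of_mem_seg hc hy (hcr.trans hdist.symm)
    have hg := hfree (g * (FreeGroup.mk (l.take k))⁻¹) (by rw [mul_smul, ← hcy, hgc])
    rw [← hdir, mul_inv_eq_one.1 hg, edgeDirection_mk_take hl hk]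
  · rintro rfl
    exact ⟨_, _, hy, hdist, smul_inv_smul _ _, edgeDirection_mk_take hl hk⟩

/-- A tripod formed by two reduced words with distinct first letters at its foot `p`, and highest
at `p`, is not higher than the total displacement of `p`. -/
theorem dist_le_totalDisplacement [Fintype ι]
    (hiso : ∀ g : FreeGroup ι, Isometry fun x : T => g • x) {A : Set T} (hA : IsSubtree A)
    (hinv : ∀ g : FreeGroup ι, ∀ x ∈ A, g • x ∈ A)
    (hfix : ∀ g : FreeGroup ι, g ≠ 1 → ∀ x ∈ A, ∀ y ∈ A, g • x = x → g • y = y → x = y)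
    {p m : T} (hp : p ∈ A) {l l' : List (ι × Bool)} (hl : FreeGroup.IsReduced l)
    (hl' : FreeGroup.IsReduced l') (hhead : l'.head? ≠ l.head?)
    (hm : m ∈ seg p (FreeGroup.mk l • p)) (hm' : m ∈ seg p (FreeGroup.mk l' • p))
    (hle : ∀ k < l.length, dist (walk p l k) m ≤ dist p m)
    (hle' : ∀ k < l'.length, dist (walk p l' k) m ≤ dist p m) :
    dist p m ≤ totalDisplacement ι p := by
  classical
  have hx : ∀ t ∈ Ico 0 (dist p m), ∃ x ∈ seg p m, dist p x = t := fun t ht =>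
    exists_mem_seg ht.1 ht.2.le
  have : Nonempty T := ⟨p⟩
  choose! x hxs hxd using hx
  have hxA : ∀ t ∈ Ico 0 (dist p m), x t ∈ A := fun t ht =>
    hA p hp _ (hinv _ p hp) (mem_seg_of_mem_left hm (hxs t ht))
  have hend := fun t (ht : t ∈ Ico 0 (dist p m)) =>
    exists_end hiso hm (hxs t ht) ((hxd t ht).trans_lt ht.2)
  have hend' := fun t (ht : t ∈ Ico 0 (dist p m)) =>
    exists_end hiso hm' (hxs t ht) ((hxd t ht).trans_lt ht.2)
  rcases (dist_nonneg (x := p) (y := m)).eq_or_lt with h0 | h0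
  · rw [← h0]
    exact Finset.sum_nonneg fun z _ => dist_nonneg
  have h0' : (0 : ℝ) ∈ Ico 0 (dist p m) := ⟨le_rfl, h0⟩
  have : Nonempty (Fin l.length) := ⟨(hend 0 h0').choose⟩
  have : Nonempty (Fin l'.length) := ⟨(hend' 0 h0').choose⟩
  choose! k hkx hkj using hend
  choose! k' hkx' hkj' using hend'
  have hdist : ∀ t ∈ Ico 0 (dist p m), dist (x t) m = dist p m - t := by
    intro t ht
    have h1 := mem_seg.1 (hxs t ht)
    rw [hxd t ht] at h1
    linarith
  have hlow : ∀ t ∈ Ico 0 (dist p m), ∀ j ≤ (k t : ℕ), dist (walk p l j) (x t) ≤ t := by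
    intro t ht j hj
    have h1 := mem_seg.1 (hkj t ht j hj)
    linarith [hdist t ht, hle j (hj.trans_lt (k t).2)]
  have hlow' : ∀ t ∈ Ico 0 (dist p m), ∀ j ≤ (k' t : ℕ), dist (walk p l' j) (x t) ≤ t := by
    intro t ht j hj
    have h1 := mem_seg.1 (hkj' t ht j hj)
    linarith [hdist t ht, hle' j (hj.trans_lt (k' t).2)]
  refine le_sum_of_separating (fun z => dist_nonneg) (ℓ := dist p m)
    (D := (Finset.range l.length).image (fun j => dist (walk p l j) m - dist p m) ∪
      (Finset.range l'.length).image (fun j => dist (walk p l' j) m - dist p m))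
    (B := {t | t ∈ Ico 0 (dist p m) ∧ ∃ g : FreeGroup ι, g ≠ 1 ∧ g • x t = x t}) ?_
    (fun t => (l[k t], dist (walk p l (k t)) (x t)))
    (fun t => (l'[k' t], dist (walk p l' (k' t)) (x t))) ?_ ?_ ?_
  · have hsub : {t | t ∈ Ico 0 (dist p m) ∧ ∃ g : FreeGroup ι, g ≠ 1 ∧ g • x t = x t} ⊆
        ⋃ g : {g : FreeGroup ι // g ≠ 1}, {t | t ∈ Ico 0 (dist p m) ∧ g.1 • x t = x t} := by
      rintro t ⟨ht, g, hg, h⟩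
      exact mem_iUnion.2 ⟨⟨g, hg⟩, ht, h⟩
    refine (countable_iUnion fun g => Set.Subsingleton.countable ?_).mono hsub
    rintro t ⟨ht, h⟩ t' ⟨ht', h'⟩
    rw [← hxd t ht, ← hxd t' ht', hfix g.1 g.2 _ (hxA t ht) _ (hxA t' ht') h h']
  · intro t ht
    have h1 := mem_seg.1 (hkj t ht _ le_rfl)
    refine ⟨Finset.mem_union_left _ (Finset.mem_image.2 ⟨k t, Finset.mem_range.2 (k t).2, ?_⟩),
      dist_nonneg, ?_⟩
    · linarith [hdist t ht]
    · have h2 := dist_le_of_mem_seg (hkx t ht)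
      rwa [← (hiso (FreeGroup.mk (l.take (k t)))).dist_eq, smul_inv_smul] at h2
  · intro t ht
    have h1 := mem_seg.1 (hkj' t ht _ le_rfl)
    refine ⟨Finset.mem_union_right _ (Finset.mem_image.2 ⟨k' t, Finset.mem_range.2 (k' t).2, ?_⟩),
      dist_nonneg, ?_⟩
    · linarith [hdist t ht]
    · have h2 := dist_le_of_mem_seg (hkx' t ht)
      rwa [← (hiso (FreeGroup.mk (l'.take (k' t)))).dist_eq, smul_inv_smul] at h2
  · intro t ht htB
    have hfree : ∀ g : FreeGroup ι, g • x t = x t → g = 1 := by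
      intro g hg
      by_contra hne
      exact htB ⟨ht, g, hne, hg⟩
    refine ⟨(· ∈ passingSet p (x t) l.head?), ?_, ?_, ?_⟩
    · exact (mem_passingSet_iff_of_free hiso hl (k t).2 (hkx t ht) hfree _).2 rfl
    · exact fun h => hhead ((mem_passingSet_iff_of_free hiso hl' (k' t).2 (hkx' t ht) hfree _).1 h)
    · intro t' ht'
      have ht'' : t' ∈ Ico 0 (dist p m) := ⟨ht'.1, ht'.2.trans ht.2⟩
      refine (mem_passingSet_iff hiso (k t').2 (hkx t' ht'') (fun j hj => ?_) _).trans
        (mem_passingSet_iff hiso (k' t').2 (hkx' t' ht'') (fun j hj => ?_) _).symm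
      · rw [hxd t ht]
        exact (hlow t' ht'' j hj).trans_lt ht'.2
      · rw [hxd t ht]
        exact (hlow' t' ht'' j hj).trans_lt ht'.2

end Walks

end CHL

namespace CHL

section Backtracking

/-- A point `m` from which the sequence `q` strays at time `s` lies at the foot of an excursion
of `q` which is at least as high. -/
theorem exists_highest_excursion {T : Type*} [MetricSpace T] [IsRTree T] {q : ℕ → T} {i s j : ℕ}
    {m : T} (his : i ≤ s) (hsj : s ≤ j) (hi : m ∈ seg (q s) (q i)) (hj : m ∈ seg (q s) (q j))
    (hm : m ≠ q s) :
    ∃ lo s' hi, i ≤ lo ∧ lo < s' ∧ s' < hi ∧ hi ≤ j ∧ m ∈ seg (q s') (q lo) ∧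
      m ∈ seg (q s') (q hi) ∧ dist (q s) m ≤ dist (q s') m ∧
      ∀ k, lo < k → k < hi → dist (q k) m ≤ dist (q s') m := by
  classical
  have hne : ∀ k, m ∈ seg (q s) (q k) → k ≠ s := by
    rintro k hk rfl
    exact hm (eq_of_mem_seg_self hk)
  obtain ⟨lo, hlo, hlomax⟩ :=
    ((Finset.Icc i s).filter fun k => m ∈ seg (q s) (q k)).exists_max_image id
      ⟨i, by simp [his, hi]⟩
  obtain ⟨hi', hhi, himin⟩ :=
    ((Finset.Icc s j).filter fun k => m ∈ seg (q s) (q k)).exists_min_image id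
      ⟨j, by simp [hsj, hj]⟩
  simp only [Finset.mem_filter, Finset.mem_Icc, id] at hlo hlomax hhi himin
  have hlos : lo < s := lt_of_le_of_ne hlo.1.2 (hne _ hlo.2)
  have hshi : s < hi' := lt_of_le_of_ne hhi.1.1 (hne _ hhi.2).symm
  have hbetween : ∀ k, lo < k → k < hi' → m ∉ seg (q s) (q k) := by
    intro k h1 h2 hk
    rcases le_total k s with h | h
    · exact absurd (hlomax k ⟨⟨hlo.1.1.trans h1.le, h⟩, hk⟩) (by omega)
    · exact absurd (himin k ⟨⟨h, h2.le.trans hhi.1.2⟩, hk⟩) (by omega)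
  obtain ⟨s', hs', hmax⟩ := (Finset.Ioo lo hi').exists_max_image (fun k => dist (q k) m)
    ⟨s, by simp [hlos, hshi]⟩
  simp only [Finset.mem_Ioo] at hs' hmax
  have hs'm := hbetween s' hs'.1 hs'.2
  exact ⟨lo, s', hi', hlo.1.1, hs'.1, hs'.2, hhi.1.2, (seg_split hlo.2 _).resolve_left hs'm,
    (seg_split hhi.2 _).resolve_left hs'm, hmax s ⟨hlos, hshi⟩, fun k h1 h2 => hmax k ⟨h1, h2⟩⟩

variable {ι : Type*}

theorem mk_take_drop (l : List (ι × Bool)) (s k : ℕ) :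
    FreeGroup.mk ((l.drop s).take k) =
      (FreeGroup.mk (l.take s))⁻¹ * FreeGroup.mk (l.take (s + k)) := by
  rw [List.take_add, ← FreeGroup.mul_mk, inv_mul_cancel_left]

theorem mk_take_invRev_take (l : List (ι × Bool)) {s k : ℕ} (hs : s ≤ l.length) (hk : k ≤ s) :
    FreeGroup.mk ((FreeGroup.invRev (l.take s)).take k) =
      (FreeGroup.mk (l.take s))⁻¹ * FreeGroup.mk (l.take (s - k)) := by
  have h1 : (FreeGroup.invRev (l.take s)).take k = FreeGroup.invRev ((l.drop (s - k)).take k) := by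
    have h2 : l.take s = l.take (s - k) ++ (l.drop (s - k)).take k := by
      rw [← List.take_add, Nat.sub_add_cancel hk]
    rw [h2, FreeGroup.invRev_append, List.take_left']
    rw [FreeGroup.invRev_length, List.length_take, List.length_drop]
    omega
  rw [h1, ← FreeGroup.inv_mk, mk_take_drop, Nat.sub_add_cancel hk, mul_inv_rev, inv_inv]

theorem head?_invRev (l : List (ι × Bool)) :
    (FreeGroup.invRev l).head? = l.getLast?.map invLetter := by
  rw [FreeGroup.invRev, List.head?_reverse, List.getLast?_map]
  rfl

variable [DecidableEq ι]

theorem isReduced_invRev {l : List (ι × Bool)} (h : FreeGroup.IsReduced l) :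
    FreeGroup.IsReduced (FreeGroup.invRev l) := by
  rw [← toWord_mk_of_isReduced h, ← FreeGroup.toWord_inv]
  exact FreeGroup.isReduced_toWord

/-- Bounded backtracking: the path read along a reduced word strays from the geodesic between
any two of its points at most by the total displacement of its origin. -/
theorem dist_walk_le_totalDisplacement [Fintype ι] {T : Type*} [MetricSpace T] [IsRTree T]
    [MulAction (FreeGroup ι) T]
    (hiso : ∀ g : FreeGroup ι, Isometry fun x : T => g • x) {A : Set T} (hA : IsSubtree A)
    (hinv : ∀ g : FreeGroup ι, ∀ x ∈ A, g • x ∈ A)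
    (hfix : ∀ g : FreeGroup ι, g ≠ 1 → ∀ x ∈ A, ∀ y ∈ A, g • x = x → g • y = y → x = y)
    {p m : T} (hp : p ∈ A) {l : List (ι × Bool)} (hl : FreeGroup.IsReduced l) {i s j : ℕ}
    (his : i ≤ s) (hsj : s ≤ j) (hj : j ≤ l.length)
    (hmi : m ∈ seg (walk p l s) (walk p l i)) (hmj : m ∈ seg (walk p l s) (walk p l j)) :
    dist (walk p l s) m ≤ totalDisplacement ι p := by
  by_cases hm : m = walk p l s
  · rw [hm, dist_self]
    exact Finset.sum_nonneg fun z _ => dist_nonneg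
  obtain ⟨lo, t, hi, -, hlot, hthi, hhi, hmlo, hmhi, hst, hmax⟩ :=
    exists_highest_excursion his hsj hmi hmj hm
  refine hst.trans ?_
  set g := FreeGroup.mk (l.take t) with hg
  have hwalk : ∀ k, g⁻¹ • walk p l (t + k) = walk p (l.drop t) k := by
    intro k
    rw [walk, walk, mk_take_drop, mul_smul]
  have hwalk' : ∀ k ≤ t, g⁻¹ • walk p l (t - k) = walk p (FreeGroup.invRev (l.take t)) k := by
    intro k hk
    rw [walk, walk, mk_take_invRev_take l (by omega) hk, mul_smul]
  have hgp : g⁻¹ • walk p l t = p := by rw [walk, inv_smul_smul]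
  have hdist : ∀ x, dist (g⁻¹ • x) (g⁻¹ • m) = dist x m := fun x => (hiso g⁻¹).dist_eq x m
  have hdp : dist p (g⁻¹ • m) = dist (walk p l t) m := by rw [← hdist, hgp]
  have htake : ∀ (l₁ : List (ι × Bool)) {k n : ℕ}, k ≤ n → walk p (l₁.take n) k = walk p l₁ k := by
    intro l₁ k n hkn
    rw [walk, walk, List.take_take, min_eq_left hkn]
  have hred : FreeGroup.IsReduced (l.take t ++ l.drop t) := by rwa [List.take_append_drop]
  obtain ⟨hred1, hred2, hred3⟩ := isReduced_append_iff.1 hred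
  have key := dist_le_totalDisplacement hiso hA hinv hfix (m := g⁻¹ • m) hp
    (l := (l.drop t).take (hi - t)) (l' := (FreeGroup.invRev (l.take t)).take (t - lo))
    (hred2.infix (List.take_prefix _ _).isInfix)
    ((isReduced_invRev hred1).infix (List.take_prefix _ _).isInfix) ?_ ?_ ?_ ?_ ?_
  · rwa [hdp] at key
  · rw [List.head?_take, List.head?_take, if_neg (by omega), if_neg (by omega), head?_invRev]
    rw [List.head?_drop, List.getElem?_eq_getElem (by omega), Ne, Option.map_eq_some_iff]
    rintro ⟨a, ha, hab⟩
    refine hred3 a ha _ ?_ hab.symm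
    rw [List.head?_drop, List.getElem?_eq_getElem (by omega)]
    rfl
  · have h1 : FreeGroup.mk ((l.drop t).take (hi - t)) • p = g⁻¹ • walk p l hi := by
      have := hwalk (hi - t)
      rw [show t + (hi - t) = hi by omega] at this
      exact this.symm
    have h2 := (seg_smul hiso g⁻¹).2 hmhi
    rwa [hgp, ← h1] at h2
  · have h1 : FreeGroup.mk ((FreeGroup.invRev (l.take t)).take (t - lo)) • p =
        g⁻¹ • walk p l lo := by
      have := hwalk' (t - lo) (by omega)
      rw [show t - (t - lo) = lo by omega] at this
      exact this.symm
    have h2 := (seg_smul hiso g⁻¹).2 hmlo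
    rwa [hgp, ← h1] at h2
  · intro k hk
    rw [List.length_take] at hk
    have hk' : k < hi - t := hk.trans_le (min_le_left _ _)
    rw [htake _ hk'.le, ← hwalk, hdist, hdp]
    exact hmax _ (by omega) (by omega)
  · intro k hk
    rw [List.length_take] at hk
    have hk' : k < t - lo := hk.trans_le (min_le_left _ _)
    rw [htake _ hk'.le, ← hwalk' k (by omega), hdist, hdp]
    exact hmax _ (by omega) (by omega)

end Backtracking

end CHL

namespace CHL

section Lift

theorem exists_mem_seg_succ {T : Type*} [MetricSpace T] [IsRTree T] {q : ℕ → T} {a b : ℕ}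
    (hab : a < b) {x : T} (hx : x ∈ seg (q a) (q b)) :
    ∃ k, a ≤ k ∧ k < b ∧ x ∈ seg (q k) (q (k + 1)) := by
  induction b, hab using Nat.le_induction with
  | base => exact ⟨a, le_rfl, Nat.lt_succ_self a, hx⟩
  | succ b hb ih =>
    rcases seg_split hx (q b) with h | h
    · obtain ⟨k, h1, h2, h3⟩ := ih h
      exact ⟨k, h1, h2.trans (Nat.lt_succ_self b), h3⟩
    · exact ⟨b, (Nat.lt_of_succ_le hb).le, Nat.lt_succ_self b, h⟩

variable {ι : Type*} {T : Type*} [MetricSpace T] [MulAction (FreeGroup ι) T]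

theorem dist_walk_walk_succ (hiso : ∀ g : FreeGroup ι, Isometry fun x : T => g • x) (p : T)
    {l : List (ι × Bool)} {k : ℕ} (hk : k < l.length) :
    dist (walk p l k) (walk p l (k + 1)) = dist p (letterElt l[k] • p) := by
  rw [walk_succ p hk]
  exact (hiso _).dist_eq _ _

variable [IsRTree T]

/-- The points at which the path read from `p` along `l` branches off the geodesics to its end. -/
def branchPoints (p : T) (l : List (ι × Bool)) : Set T :=
  insert p ((fun k => (exists_center (walk p l k) (walk p l (k + 1)) (walk p l l.length)).choose) ''
    Iio l.length)

/-- The branch points close to the path, moved back to the `R`-ball around `p`. -/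
def nearBranchPoints (R : ℝ) (p : T) (l : List (ι × Bool)) : Set T :=
  Metric.closedBall p R ∩
    ⋃ k ∈ Iic l.length, (fun x => (FreeGroup.mk (l.take k))⁻¹ • x) '' branchPoints p l

theorem finite_nearBranchPoints (R : ℝ) (p : T) (l : List (ι × Bool)) :
    (nearBranchPoints R p l).Finite :=
  ((finite_Iic _).biUnion fun _ _ => (((finite_Iio _).image _).insert p).image _).inter_of_right _

theorem mem_nearBranchPoints (hiso : ∀ g : FreeGroup ι, Isometry fun x : T => g • x) {R : ℝ}
    {p x : T} {l : List (ι × Bool)} (hx : x ∈ branchPoints p l) {k : ℕ} (hk : k ≤ l.length)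
    (hd : dist (walk p l k) x ≤ R) :
    (FreeGroup.mk (l.take k))⁻¹ • x ∈ nearBranchPoints R p l := by
  refine ⟨?_, mem_biUnion (mem_Iic.2 hk) ⟨x, hx, rfl⟩⟩
  rwa [Metric.mem_closedBall', ← (hiso (FreeGroup.mk (l.take k))).dist_eq, smul_inv_smul]

/-- Suppose that a path in `T` backtracks at most by `R` and that a subtree `K` contains `p`, its
translates by the letters, and the branch points of the path near it. Then the lift of the path by
a map which is isometric on `K` and compatible with the letters is not longer than in `T`. -/
theorem dist_lift_le {Y : Type*} [MetricSpace Y] [MulAction (FreeGroup ι) Y]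
    (hiso : ∀ g : FreeGroup ι, Isometry fun x : T => g • x)
    (hisoY : ∀ g : FreeGroup ι, Isometry fun x : Y => g • x) {K : Set T} (hK : IsSubtree K)
    {e : T → Y} (he : ∀ x ∈ K, ∀ y ∈ K, dist (e x) (e y) = dist x y)
    (hcompat : ∀ z : ι × Bool, ∀ x ∈ K, (letterElt z)⁻¹ • x ∈ K →
      (letterElt z)⁻¹ • e x = e ((letterElt z)⁻¹ • x))
    {R : ℝ} {p : T} (hp : p ∈ K) (hpz : ∀ z : ι × Bool, letterElt z • p ∈ K)
    {l : List (ι × Bool)} (hbr : nearBranchPoints R p l ⊆ K)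
    (hR : ∀ i s j x, i ≤ s → s ≤ j → j < l.length → x ∈ seg (walk p l i) (walk p l (i + 1)) →
      x ∈ seg (walk p l j) (walk p l (j + 1)) → dist (walk p l s) x ≤ R) :
    dist (e p) (FreeGroup.mk l • e p) ≤ dist p (FreeGroup.mk l • p) := by
  set g : ℕ → FreeGroup ι := fun k => FreeGroup.mk (l.take k) with hg
  set q : ℕ → T := walk p l with hq
  set n := l.length with hn
  have hgn : g n = FreeGroup.mk l := by simp [hg, hn]
  have hqn : q n = FreeGroup.mk l • p := walk_length p l
  have hedge : ∀ k < n, ∀ x ∈ seg (q k) (q (k + 1)), (g k)⁻¹ • x ∈ K := by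
    intro k hk x hx
    refine hK p hp _ (hpz l[k]) ?_
    rw [← seg_smul hiso (g k), smul_inv_smul]
    rw [hq, walk_succ p hk] at hx
    exact hx
  have hstep : ∀ k < n, ∀ x, (g k)⁻¹ • x ∈ K → (g (k + 1))⁻¹ • x ∈ K →
      g k • e ((g k)⁻¹ • x) = g (k + 1) • e ((g (k + 1))⁻¹ • x) := by
    intro k hk x h1 h2
    have hs : g (k + 1) = g k * letterElt l[k] := mk_take_succ hk
    rw [hs, mul_inv_rev, mul_smul] at h2
    rw [hs, mul_inv_rev, mul_smul (letterElt l[k])⁻¹, ← hcompat _ _ h1 h2, mul_smul, smul_inv_smul]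
  have hmove : ∀ i j x, i ≤ j → j < n → x ∈ branchPoints p l → x ∈ seg (q i) (q (i + 1)) →
      x ∈ seg (q j) (q (j + 1)) → g i • e ((g i)⁻¹ • x) = g j • e ((g j)⁻¹ • x) := by
    intro i j x hij hj hx hxi hxj
    have hmem : ∀ s, i ≤ s → s ≤ j → (g s)⁻¹ • x ∈ K := fun s h1 h2 =>
      hbr (mem_nearBranchPoints hiso hx (h2.trans hj.le) (hR i s j x h1 h2 hj hxi hxj))
    have hmain : ∀ s, i ≤ s → s ≤ j → g i • e ((g i)⁻¹ • x) = g s • e ((g s)⁻¹ • x) := by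
      intro s hs
      induction s, hs using Nat.le_induction with
      | base => intro _; rfl
      | succ s hs ih =>
        intro h
        rw [ih (Nat.le_of_succ_le h)]
        exact hstep s (by omega) x (hmem s hs (by omega)) (hmem (s + 1) (by omega) h)
    exact hmain j hij le_rfl
  have hsame : ∀ k x y, (g k)⁻¹ • x ∈ K → (g k)⁻¹ • y ∈ K →
      dist (g k • e ((g k)⁻¹ • x)) (g k • e ((g k)⁻¹ • y)) = dist x y := by
    intro k x y hx hy
    rw [(hisoY (g k)).dist_eq, he _ hx _ hy, (hiso (g k)⁻¹).dist_eq]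
  have hclaim : ∀ d k x, k + d + 1 = n → x ∈ branchPoints p l → x ∈ seg (q k) (q (k + 1)) →
      dist (g k • e ((g k)⁻¹ • x)) (g n • e p) ≤ dist x (q n) := by
    intro d
    induction d using Nat.strong_induction_on with
    | _ d ih =>
      intro k x hkd hx hxk
      have hlater : ∀ y ∈ branchPoints p l, y ∈ seg (q k) (q (k + 1)) →
          ∀ j, k < j → j < n → y ∈ seg (q j) (q (j + 1)) →
          dist (g k • e ((g k)⁻¹ • y)) (g n • e p) ≤ dist y (q n) := by
        intro y hy hyk j hkj hj hyj
        rw [hmove k j y hkj.le hj hy hyk hyj]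
        exact ih (n - j - 1) (by omega) j y (by omega) hy hyj
      by_cases hex : ∃ j, k < j ∧ j < n ∧ x ∈ seg (q j) (q (j + 1))
      · obtain ⟨j, hkj, hj, hxj⟩ := hex
        exact hlater x hx hxk j hkj hj hxj
      have hkn : k < n := by omega
      have hkK := hedge k hkn x hxk
      rcases Nat.eq_zero_or_pos d with rfl | hd
      · have hkn1 : k + 1 = n := hkd
        have h1 : g n • e p = g k • e ((g k)⁻¹ • q n) := by
          have h2 : (g n)⁻¹ • q n = p := inv_smul_smul _ _
          rw [← hkn1] at h2 ⊢
          rw [hstep k hkn (q (k + 1)) (hedge k hkn _ (right_mem_seg _ _)) (by rwa [h2]), h2]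
        rw [h1, hsame k _ _ hkK (hedge k hkn _ (by rw [← hkn1]; exact right_mem_seg _ _))]
      · obtain ⟨hc1, hc2, hc3⟩ := (exists_center (q k) (q (k + 1)) (q n)).choose_spec
        have hcbr : (exists_center (q k) (q (k + 1)) (q n)).choose ∈ branchPoints p l :=
          mem_insert_of_mem _ ⟨k, hkn, rfl⟩
        set c := (exists_center (q k) (q (k + 1)) (q n)).choose
        obtain ⟨j, hj1, hj2, hcj⟩ := exists_mem_seg_succ (by omega : k + 1 < n) hc3
        have h1 := hlater c hcbr hc1 j (by omega) hj2 hcj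
        have hxc : x ∈ seg (q k) c := by
          refine (seg_split hxk c).resolve_right fun h => hex ?_
          rw [seg_comm] at h
          obtain ⟨j, hj1, hj2, hj3⟩ := exists_mem_seg_succ (by omega : k + 1 < n)
            (mem_seg_of_mem_left hc3 h)
          exact ⟨j, by omega, hj2, hj3⟩
        have h2 := mem_seg.1 (mem_seg_of_mem_left' hc2 hxc)
        calc _ ≤ dist (g k • e ((g k)⁻¹ • x)) (g k • e ((g k)⁻¹ • c)) +
              dist (g k • e ((g k)⁻¹ • c)) (g n • e p) := dist_triangle _ _ _
          _ ≤ dist x c + dist c (q n) := by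
            rw [hsame k _ _ hkK (hedge k hkn _ hc1)]
            linarith
          _ = _ := h2
  rcases Nat.eq_zero_or_pos n with h0 | h0
  · have : l = [] := List.length_eq_zero_iff.1 h0
    subst this
    rw [← FreeGroup.one_eq_mk, one_smul, one_smul, dist_self, dist_self]
  · have h1 := hclaim (n - 1) 0 p (by omega) (mem_insert _ _)
      (by rw [hq, walk_zero]; exact left_mem_seg _ _)
    rwa [hgn, hqn, show g 0 = 1 from rfl, one_smul, inv_one, one_smul] at h1

end Lift

end CHL

namespace CHL

theorem dist_letterElt_smul_le {ι : Type*} [Fintype ι] {T : Type*} [MetricSpace T]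
    [MulAction (FreeGroup ι) T] (p : T) (z : ι × Bool) :
    dist p (letterElt z • p) ≤ totalDisplacement ι p :=
  Finset.single_le_sum (f := fun z : ι × Bool => dist p (letterElt z • p))
    (fun _ _ => dist_nonneg) (Finset.mem_univ z)

theorem totalDisplacement_nonneg {ι : Type*} [Fintype ι] {T : Type*} [MetricSpace T]
    [MulAction (FreeGroup ι) T] (p : T) : 0 ≤ totalDisplacement ι p :=
  Finset.sum_nonneg fun _ _ => dist_nonneg

/-- If two edges of the path read along a reduced word meet, then the path stays close to their
intersection in between. -/
theorem dist_walk_le_of_mem_seg_of_mem_seg {ι : Type*} [DecidableEq ι] [Fintype ι] {T : Type*}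
    [MetricSpace T] [IsRTree T] [MulAction (FreeGroup ι) T]
    (hiso : ∀ g : FreeGroup ι, Isometry fun x : T => g • x) {A : Set T} (hA : IsSubtree A)
    (hinv : ∀ g : FreeGroup ι, ∀ x ∈ A, g • x ∈ A)
    (hfix : ∀ g : FreeGroup ι, g ≠ 1 → ∀ x ∈ A, ∀ y ∈ A, g • x = x → g • y = y → x = y)
    {p x : T} (hp : p ∈ A) {l : List (ι × Bool)} (hl : FreeGroup.IsReduced l) {i s j : ℕ}
    (his : i ≤ s) (hsj : s ≤ j) (hj : j < l.length) (hxi : x ∈ seg (walk p l i) (walk p l (i + 1)))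
    (hxj : x ∈ seg (walk p l j) (walk p l (j + 1))) :
    dist (walk p l s) x ≤ 2 * totalDisplacement ι p := by
  have hedge : ∀ k < l.length,
      dist (walk p l k) (walk p l (k + 1)) ≤ totalDisplacement ι p := fun k hk =>
    (dist_walk_walk_succ hiso p hk).trans_le (dist_letterElt_smul_le p _)
  have h1 := hedge i (by omega)
  have h2 := hedge j hj
  obtain ⟨m, hmi, hmj, hm⟩ := exists_center (walk p l s) (walk p l i) (walk p l (j + 1))
  have hsm := dist_walk_le_totalDisplacement hiso hA hinv hfix hp hl his
    (hsj.trans (Nat.le_succ j)) hj hmi hmj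
  have hmx : dist m x ≤ totalDisplacement ι p := by
    have h3 := mem_seg.1 hxi
    have h4 := mem_seg.1 hxj
    have h5 := dist_nonneg (x := x) (y := walk p l (i + 1))
    have h6 := dist_nonneg (x := walk p l j) (y := x)
    rcases seg_split hm x with h | h
    · have h7 := mem_seg.1 h
      have h8 := dist_nonneg (x := walk p l i) (y := m)
      linarith
    · have h7 := mem_seg.1 h
      have h8 := dist_nonneg (x := m) (y := walk p l (j + 1))
      rw [dist_comm x m] at h7
      linarith
  linarith [dist_triangle (walk p l s) m x]

namespace TreeSetup

variable {ι : Type} (St : TreeSetup ι)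

theorem eq_of_smul_eq_self {g : FreeGroup ι} (hg : g ≠ 1) {x y : St.Tb} (hx : x ∈ St.Tsub)
    (hy : y ∈ St.Tsub) (hgx : g • x = x) (hgy : g • y = y) : x = y := by
  have := St.tree
  by_contra hxy
  refine hg (St.arc_stab g x hx y hy hxy ?_)
  ext z
  constructor
  · rintro ⟨z, hz, rfl⟩
    have h := (seg_smul St.act_isom g).2 hz
    rwa [hgx, hgy] at h
  · intro hz
    refine ⟨g⁻¹ • z, ?_, smul_inv_smul _ _⟩
    rw [← seg_smul St.act_isom g, smul_inv_smul, hgx, hgy]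
    exact hz

end TreeSetup

theorem InducedAssoc.letterElt_smul_emb {ι : Type} {St : TreeSetup ι} {K : Set St.Tb}
    (IA : InducedAssoc St K) (z : ι × Bool) (x : K)
    (h : (letterElt z)⁻¹ • (x : St.Tb) ∈ K) :
    (letterElt z)⁻¹ • IA.emb x = IA.emb ⟨(letterElt z)⁻¹ • (x : St.Tb), h⟩ := by
  obtain ⟨i, _ | _⟩ := z
  · have h1 : (FreeGroup.of i)⁻¹ • (letterElt (i, false))⁻¹ • (x : St.Tb) = x := inv_smul_smul _ _
    have h2 := IA.compat i ⟨_, h⟩ (by rw [h1]; exact x.2)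
    have h3 : (⟨(FreeGroup.of i)⁻¹ • (letterElt (i, false))⁻¹ • (x : St.Tb),
        by rw [h1]; exact x.2⟩ : K) = x := Subtype.ext h1
    rw [h3, inv_smul_eq_iff] at h2
    exact h2.symm
  · exact IA.compat i x h

/-- The displacement of a base point in `T_𝒦` agrees with that in `T̄`, provided that `𝒦` contains
the branch points of the path read along the word near that path. -/
theorem InducedAssoc.dist_emb_smul_emb {ι : Type} [DecidableEq ι] [Fintype ι] {St : TreeSetup ι}
    {K : Set St.Tb} (IA : InducedAssoc St K) (hK : IsSubtree K)
    (hj : ∀ X Y : IA.TK, dist (IA.jmap X) (IA.jmap Y) ≤ dist X Y) {p : St.Tb}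
    (hpT : p ∈ St.Tsub) (hp : p ∈ K) (hpz : ∀ z : ι × Bool, letterElt z • p ∈ K) {w : FreeGroup ι}
    (hbr : haveI := St.tree; nearBranchPoints (2 * totalDisplacement ι p) p w.toWord ⊆ K) :
    dist (IA.emb ⟨p, hp⟩) (w • IA.emb ⟨p, hp⟩) = dist p (w • p) := by
  classical
  have := St.tree
  refine le_antisymm ?_ ?_
  · set e : St.Tb → IA.TK := fun x => if h : x ∈ K then IA.emb ⟨x, h⟩ else IA.emb ⟨p, hp⟩
    have he : ∀ x (hx : x ∈ K), e x = IA.emb ⟨x, hx⟩ := fun x hx => dif_pos hx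
    have h := dist_lift_le (e := e) St.act_isom IA.act_isom hK
      (fun x hx y hy => by rw [he x hx, he y hy, IA.emb_isom.dist_eq]; rfl)
      (fun z x hx hzx => by rw [he x hx, he _ hzx, IA.letterElt_smul_emb z ⟨x, hx⟩ hzx])
      hp hpz hbr fun i s j x his hsj hj hxi hxj =>
        dist_walk_le_of_mem_seg_of_mem_seg St.act_isom St.sub_subtree St.invariant
          (fun g hg x hx y hy => St.eq_of_smul_eq_self hg hx hy) hpT
          FreeGroup.isReduced_toWord his hsj hj hxi hxj
    rwa [FreeGroup.mk_toWord, he p hp] at h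
  · have h := hj (IA.emb ⟨p, hp⟩) (w • IA.emb ⟨p, hp⟩)
    rwa [IA.jmap_equivariant, IA.jmap_emb] at h

/-- The finite trees approximating `T`: the hull of a point `p`, its translates by the letters and
the branch points needed for finitely many words. -/
theorem exists_isFiniteSubtree {ι : Type} [DecidableEq ι] [Fintype ι] (St : TreeSetup ι)
    (p : St.Tb) (W : Set (FreeGroup ι)) (hW : W.Finite) :
    haveI := St.tree
    ∃ K : Set St.Tb, IsFiniteSubtree K ∧ IsCompact K ∧ IsSubtree K ∧
      K ⊆ Metric.closedBall p (2 * totalDisplacement ι p) ∧ p ∈ K ∧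
      (∀ z : ι × Bool, letterElt z • p ∈ K) ∧
      ∀ w ∈ W, nearBranchPoints (2 * totalDisplacement ι p) p w.toWord ⊆ K := by
  have := St.tree
  set R := 2 * totalDisplacement ι p
  have hL := totalDisplacement_nonneg (ι := ι) p
  set S : Set St.Tb := {p} ∪ range (fun z : ι × Bool => letterElt z • p) ∪
    ⋃ w ∈ W, nearBranchPoints R p w.toWord
  have hS : S.Finite := ((finite_singleton p).union (finite_range _)).union
    (hW.biUnion fun w _ => finite_nearBranchPoints R p w.toWord)
  have hSK : S ⊆ subtreeHull S := subset_subtreeHull S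
  have hF : ((hS.toFinset : Finset St.Tb) : Set St.Tb) = S := hS.coe_toFinset
  refine ⟨subtreeHull S, ⟨hS.toFinset, by rw [hF]⟩, ?_, isSubtree_subtreeHull S,
    subtreeHull_subset ?_ (isSubtree_closedBall p R), hSK (Or.inl (Or.inl rfl)),
    fun z => hSK (Or.inl (Or.inr ⟨z, rfl⟩)),
    fun w hw => (subset_biUnion_of_mem (u := fun w : FreeGroup ι =>
      nearBranchPoints R p w.toWord) hw).trans (subset_union_right.trans hSK)⟩
  · rw [← hF]
    exact isCompact_subtreeHull _
  · refine union_subset (union_subset ?_ ?_) (iUnion₂_subset fun w _ => inter_subset_left)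
    · exact singleton_subset_iff.2 (Metric.mem_closedBall_self (by positivity))
    · rintro _ ⟨z, rfl⟩
      rw [Metric.mem_closedBall']
      linarith [dist_letterElt_smul_le p z]

end CHL

namespace CHL

/-- **Corollary 6.3.**  For every very small minimal ℝ-tree `T` with isometric
`F_N`-action (`N ≥ 2`) that has dense orbits there is a sequence of finite subtrees
`K(n) ⊆ T̄`, of uniformly bounded diameter and with `K(n) ∩ aK(n) ≠ ∅` for all `a ∈ 𝒜`,
such that the trees `T_{𝒦(n)}` converge to `T`, i.e. all translation lengths converge. -/
theorem approximation_by_finite_trees {ι : Type} [Fintype ι] [DecidableEq ι]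
    (hrank : 2 ≤ Fintype.card ι) (St : TreeSetup ι) :
    ∃ C > (0 : ℝ), ∃ K : ℕ → Set St.Tb,
      (∀ n, IsFiniteSubtree (K n) ∧ Metric.diam (K n) ≤ C ∧
          ∀ i : ι, (K n ∩ FreeGroup.of i • K n).Nonempty) ∧
      ∃ IA : ∀ n, InducedAssoc St (K n),
        ∀ w : FreeGroup ι,
          Filter.Tendsto (fun n => translationLength (FreeGroup ι) ((IA n).TK) w)
            Filter.atTop (𝓝 (translationLengthOn St.Tsub w)) := by
  have := St.tree
  obtain ⟨p, hpT⟩ := St.nonempty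
  set L := totalDisplacement ι p
  have hL : 0 ≤ L := totalDisplacement_nonneg p
  obtain ⟨e, he⟩ := exists_surjective_nat (FreeGroup ι)
  choose K hfin hcpt hsub hball hp hpz hbr using fun n : ℕ => exists_isFiniteSubtree St p
    ((fun i => e i) '' Iic n ∪ (fun i => e i ^ 2) '' Iic n)
    (((finite_Iic n).image _).union ((finite_Iic n).image _))
  have hmeet : ∀ n, ∀ i : ι, (K n ∩ FreeGroup.of i • K n).Nonempty := fun n i =>
    ⟨FreeGroup.of i • p, hpz n (i, true), smul_mem_smul_set (hp n)⟩
  choose IA hIA using fun n => exists_inducedAssoc St (hcpt n) (hsub n) (hmeet n)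
  refine ⟨4 * L + 1, by positivity, K, fun n => ⟨hfin n, ?_, hmeet n⟩, IA, fun w => ?_⟩
  · have h1 := Metric.diam_mono (hball n) Metric.isBounded_closedBall
    have h2 := Metric.diam_closedBall (x := p) (show 0 ≤ 2 * L by positivity)
    linarith
  · obtain ⟨m, rfl⟩ := he w
    refine tendsto_const_nhds.congr' ?_
    filter_upwards [eventually_ge_atTop m] with n hn
    have := (IA n).tree
    rw [translationLengthOn_eq St.act_isom St.sub_subtree (e m) hpT
        (St.invariant _ p hpT),
      translationLength_eq (IA n).act_isom (e m) ((IA n).emb ⟨p, hp n⟩),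
      (IA n).dist_emb_smul_emb (hsub n) (hIA n) hpT (hp n) (hpz n)
        (hbr n _ (Or.inl ⟨m, hn, rfl⟩)),
      (IA n).dist_emb_smul_emb (hsub n) (hIA n) hpT (hp n) (hpz n)
        (hbr n _ (Or.inr ⟨m, hn, rfl⟩))]

end CHL
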